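/- arXiv:2403.02252 — 11 statements merged into one kernel-verified Lean document; each statement's English description precedes it below -/
import Mathlib

section
/- Let q(z) = Σ_{j=1}^∞ q_j z^j be a power series with q_j ≥ 0 for all j, no constant term, and 0 < q(1) := Σ_{j=1}^∞ q_j < ∞, and let Φ be analytic on the open unit disc with Φ(0) = 0. Then for every z with 0 < |z| < 1, the function r ↦ Φ(z·exp(r(q(z) − q(1)))) is integrable on (0, ∞) and ∫_0^∞ Φ(z·exp(r(q(z) − q(1)))) dr = (1/(q(1) − q(z))) · ∫_{[0,z]} (Φ(w)/w) dw, where the last integral is taken along the straight segment from 0 to z (the integrand Φ(w)/w extends analytically to w = 0 by the value Φ'(0)). -/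
open MeasureTheory

open Filter Topology Set Metric

/-- A nonzero power series with nonnegative summable coefficients and no constant term satisfies
`Re q(z) < q(1)` on the open unit disc. -/
theorem re_tsum_mul_pow_lt_tsum {q : ℕ → ℝ} (hq0 : q 0 = 0) (hqnn : ∀ j, 0 ≤ q j)
    (hsum : Summable q) (hQ1 : 0 < ∑' j, q j) {z : ℂ} (hz : ‖z‖ < 1) :
    (∑' j, (q j : ℂ) * z ^ j).re < ∑' j, q j := by
  have hle : ∀ j, ‖(q j : ℂ) * z ^ j‖ ≤ ‖z‖ * q j := by
    intro j
    rw [norm_mul, norm_pow, Complex.norm_real, Real.norm_of_nonneg (hqnn j), mul_comm]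
    rcases Nat.eq_zero_or_pos j with rfl | hj
    · simp [hq0]
    · exact mul_le_mul_of_nonneg_right
        (pow_le_of_le_one (norm_nonneg z) hz.le hj.ne') (hqnn j)
  calc (∑' j, (q j : ℂ) * z ^ j).re ≤ ‖∑' j, (q j : ℂ) * z ^ j‖ := Complex.re_le_norm _
    _ ≤ ‖z‖ * ∑' j, q j := tsum_of_norm_bounded (hsum.hasSum.mul_left _) hle
    _ < ∑' j, q j := mul_lt_of_lt_one_left hQ1 hz

/-- A function analytic on the open unit disc and vanishing at `0` is the product of the identity
with a function that has a primitive on the disc. -/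
theorem exists_hasDerivAt_of_apply_zero_eq_zero {Φ : ℂ → ℂ}
    (hΦ : AnalyticOnNhd ℂ Φ (ball 0 1)) (hΦ0 : Φ 0 = 0) :
    ∃ F g : ℂ → ℂ, ContinuousOn g (ball 0 1) ∧ (∀ w, Φ w = w * g w) ∧
      ∀ w ∈ ball (0 : ℂ) 1, HasDerivAt F (g w) w := by
  have hd : DifferentiableOn ℂ (dslope Φ 0) (ball 0 1) :=
    (Complex.differentiableOn_dslope (ball_mem_nhds 0 one_pos)).2 hΦ.differentiableOn
  obtain ⟨F, hF⟩ := hd.isExactOn_ball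
  refine ⟨F, dslope Φ 0, hd.continuousOn, fun w => ?_, hF⟩
  have h := sub_smul_dslope Φ 0 w
  rw [hΦ0] at h
  simpa using h.symm

theorem norm_mul_exp_ofReal_mul (z a : ℂ) (r : ℝ) :
    ‖z * Complex.exp (r * a)‖ = ‖z‖ * Real.exp (a.re * r) := by
  rw [norm_mul, Complex.norm_exp]
  simp [mul_comm]

theorem tendsto_mul_exp_ofReal_mul {a : ℂ} (ha : a.re < 0) (z : ℂ) :
    Tendsto (fun r : ℝ => z * Complex.exp (r * a)) atTop (𝓝 0) := by
  rw [tendsto_zero_iff_norm_tendsto_zero]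
  simp only [norm_mul_exp_ofReal_mul]
  simpa using (Real.tendsto_exp_atBot.comp
    (tendsto_id.const_mul_atTop_of_neg ha)).const_mul ‖z‖

theorem norm_mul_exp_ofReal_mul_le {a : ℂ} (ha : a.re < 0) (z : ℂ) {r : ℝ} (hr : 0 ≤ r) :
    ‖z * Complex.exp (r * a)‖ ≤ ‖z‖ := by
  rw [norm_mul_exp_ofReal_mul]
  exact mul_le_of_le_one_right (norm_nonneg z)
    (Real.exp_le_one_iff.2 (mul_nonpos_of_nonpos_of_nonneg ha.le hr))

/-- The composition of `w ↦ w * g w` with a spiral decaying to `0` is integrable. -/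
theorem integrableOn_Ioi_mul_comp_exp {g : ℂ → ℂ} (hg : ContinuousOn g (ball 0 1))
    {a z : ℂ} (ha : a.re < 0) (hz : ‖z‖ < 1) :
    IntegrableOn (fun r : ℝ => z * Complex.exp (r * a) * g (z * Complex.exp (r * a)))
      (Ioi 0) := by
  obtain ⟨C, hC⟩ := (isCompact_closedBall (0 : ℂ) ‖z‖).exists_bound_of_continuousOn
    (hg.mono (closedBall_subset_ball hz))
  have hcont : Continuous fun r : ℝ => z * Complex.exp (r * a) := by fun_prop
  have hmaps : ∀ r ∈ Ioi (0 : ℝ), z * Complex.exp (r * a) ∈ closedBall (0 : ℂ) ‖z‖ :=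
    fun r hr => mem_closedBall_zero_iff.2 (norm_mul_exp_ofReal_mul_le ha z (le_of_lt hr))
  have hint : IntegrableOn (fun r : ℝ => ‖z‖ * Real.exp (a.re * r) * C) (Ioi 0) :=
    ((integrableOn_exp_mul_Ioi ha 0).const_mul ‖z‖).mul_const C
  refine hint.mono' ?_ ?_
  · refine ContinuousOn.aestronglyMeasurable ?_ measurableSet_Ioi
    exact hcont.continuousOn.mul (hg.comp hcont.continuousOn
      fun r hr => closedBall_subset_ball hz (hmaps r hr))
  · filter_upwards [ae_restrict_mem measurableSet_Ioi] with r hr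
    rw [norm_mul, norm_mul_exp_ofReal_mul]
    gcongr
    exact hC _ (hmaps r hr)

theorem integral_Ioi_mul_comp_exp {F g : ℂ → ℂ} (hg : ContinuousOn g (ball 0 1))
    (hF : ∀ w ∈ ball (0 : ℂ) 1, HasDerivAt F (g w) w) {a z : ℂ} (ha : a.re < 0) (hz : ‖z‖ < 1) :
    ∫ r : ℝ in Ioi 0, z * Complex.exp (r * a) * g (z * Complex.exp (r * a)) =
      (F 0 - F z) / a := by
  have ha0 : a ≠ 0 := by rintro rfl; simp at ha
  have hderiv : ∀ r ∈ Ici (0 : ℝ), HasDerivAt (fun r : ℝ => F (z * Complex.exp (r * a)) / a)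
      (z * Complex.exp (r * a) * g (z * Complex.exp (r * a))) r := by
    intro r hr
    have hmem : z * Complex.exp (r * a) ∈ ball (0 : ℂ) 1 :=
      mem_ball_zero_iff.2 ((norm_mul_exp_ofReal_mul_le ha z hr).trans_lt hz)
    have hγ : HasDerivAt (fun r : ℝ => z * Complex.exp (r * a))
        (z * (Complex.exp (r * a) * (1 * a))) r :=
      (((Complex.ofRealCLM.hasDerivAt (x := r)).mul_const a).cexp).const_mul z
    have h := ((hF _ hmem).comp r hγ).div_const a
    refine h.congr_deriv ?_
    field_simp
  have hlim : Tendsto (fun r : ℝ => F (z * Complex.exp (r * a)) / a) atTop (𝓝 (F 0 / a)) :=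
    ((hF 0 (mem_ball_self one_pos)).continuousAt.tendsto.comp
      (tendsto_mul_exp_ofReal_mul ha z)).div_const a
  rw [integral_Ioi_of_hasDerivAt_of_tendsto' hderiv (integrableOn_Ioi_mul_comp_exp hg ha hz) hlim]
  simp [sub_div]

theorem integral_segment_mul_eq_sub {F g : ℂ → ℂ} (hg : ContinuousOn g (ball 0 1))
    (hF : ∀ w ∈ ball (0 : ℂ) 1, HasDerivAt F (g w) w) {z : ℂ} (hz : ‖z‖ < 1) :
    ∫ t in (0 : ℝ)..1, z * g (t * z) = F z - F 0 := by
  have hmem : ∀ t ∈ uIcc (0 : ℝ) 1, (t : ℂ) * z ∈ ball (0 : ℂ) 1 := by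
    intro t ht
    rw [uIcc_of_le zero_le_one] at ht
    rw [mem_ball_zero_iff, norm_mul, Complex.norm_real, Real.norm_of_nonneg ht.1]
    exact (mul_le_of_le_one_left (norm_nonneg z) ht.2).trans_lt hz
  have hderiv : ∀ t ∈ uIcc (0 : ℝ) 1,
      HasDerivAt (fun t : ℝ => F (t * z)) (z * g (t * z)) t := by
    intro t ht
    have hγ : HasDerivAt (fun t : ℝ => (t : ℂ) * z) (1 * z) t :=
      (Complex.ofRealCLM.hasDerivAt (x := t)).mul_const z
    have h := (hF _ (hmem t ht)).comp t hγ
    rwa [one_mul, mul_comm] at h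
  have hcont : ContinuousOn (fun t : ℝ => z * g (t * z)) (uIcc 0 1) :=
    continuousOn_const.mul (hg.comp (by fun_prop) hmem)
  rw [intervalIntegral.integral_eq_sub_of_hasDerivAt hderiv hcont.intervalIntegrable]
  simp

/-- With `q` as above and `Φ` analytic on the open unit disc with `Φ(0) = 0`,
for `0 < |z| < 1` the function `r ↦ Φ(z·exp(r(q(z) − q(1))))` is integrable on `(0,∞)` and
`∫_0^∞ Φ(z·exp(r(q(z) − q(1)))) dr = (1/(q(1) − q(z))) · ∫_{[0,z]} Φ(w)/w dw`,
where the segment integral `∫_{[0,z]} Φ(w)/w dw` is written via the parametrization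
`w = t·z`, `t ∈ [0,1]`, as `∫_0^1 Φ(t·z)/t dt` (the integrand extends by `Φ'(0)·z` at 0,
which does not affect the Lebesgue integral). -/
theorem schroder_integral_change_of_variables (q : ℕ → ℝ) (hq0 : q 0 = 0)
    (hqnn : ∀ j, 0 ≤ q j) (hsum : Summable q) (hQ1 : 0 < ∑' j, q j)
    (Φ : ℂ → ℂ) (hΦ : AnalyticOnNhd ℂ Φ (Metric.ball 0 1)) (hΦ0 : Φ 0 = 0)
    (z : ℂ) (hz0 : z ≠ 0) (hz : ‖z‖ < 1) :
    IntegrableOn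
      (fun r : ℝ => Φ (z * Complex.exp ((r : ℂ) *
        ((∑' j, (q j : ℂ) * z ^ j) - ((∑' j, q j : ℝ) : ℂ))))) (Set.Ioi 0) ∧
    ∫ r : ℝ in Set.Ioi (0 : ℝ), Φ (z * Complex.exp ((r : ℂ) *
        ((∑' j, (q j : ℂ) * z ^ j) - ((∑' j, q j : ℝ) : ℂ)))) =
      (1 / (((∑' j, q j : ℝ) : ℂ) - ∑' j, (q j : ℂ) * z ^ j)) *
        ∫ t in (0 : ℝ)..1, Φ ((t : ℂ) * z) / (t : ℂ) := by
  have ha : ((∑' j, (q j : ℂ) * z ^ j) - ((∑' j, q j : ℝ) : ℂ)).re < 0 := by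
    rw [Complex.sub_re, Complex.ofReal_re]
    exact sub_neg.2 (re_tsum_mul_pow_lt_tsum hq0 hqnn hsum hQ1 hz)
  rw [← neg_sub (∑' j, (q j : ℂ) * z ^ j)]
  set a : ℂ := (∑' j, (q j : ℂ) * z ^ j) - ((∑' j, q j : ℝ) : ℂ)
  obtain ⟨F, g, hg, hΦg, hF⟩ := exists_hasDerivAt_of_apply_zero_eq_zero hΦ hΦ0
  have hseg : ∫ t in (0 : ℝ)..1, Φ ((t : ℂ) * z) / (t : ℂ) = F z - F 0 := by
    rw [← integral_segment_mul_eq_sub hg hF hz]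
    refine intervalIntegral.integral_congr_ae (ae_of_all _ fun t ht => ?_)
    rw [uIoc_of_le zero_le_one] at ht
    have ht0 : (t : ℂ) ≠ 0 := Complex.ofReal_ne_zero.2 ht.1.ne'
    rw [hΦg]
    field_simp
  rw [hseg]
  simp only [hΦg]
  refine ⟨integrableOn_Ioi_mul_comp_exp hg ha hz, ?_⟩
  rw [integral_Ioi_mul_comp_exp hg hF ha hz, one_div, inv_neg, div_eq_mul_inv]
  ring
end

section
/- Let q(z) = Σ_{j=1}^∞ q_j z^j be a power series with q_j ≥ 0 for all j, no constant term, and 0 < q(1) := Σ_{j=1}^∞ q_j < ∞. Define Φ(z) := z·exp(∫_{[0,z]} (q'(ζ)ζ + q(ζ)) / ((q(1) − q(ζ))ζ) dζ), where the integral is along the straight segment from 0 to z and the integrand extends analytically to ζ = 0. Then Φ is analytic on the open unit disc, Φ(0) = 0, Φ'(0) = 1, and for every z with 0 < |z| < 1 one has ∫_0^∞ Φ(z·exp(r(q(z) − q(1)))) dr = Φ(z)/q(1). -/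
open MeasureTheory

/-- The power series `q(z) = Σ_{j≥1} q_j z^j` as a function on `ℂ`. -/
noncomputable def qFun (q : ℕ → ℝ) : ℂ → ℂ := fun z => ∑' j, (q j : ℂ) * z ^ j

/-- The explicit solution `Φ(z) = z·exp(∫_{[0,z]} (q'(ζ)ζ + q(ζ))/((q(1) − q(ζ))ζ) dζ)`
of the Schröder-type integral-functional equation, the segment integral being written via
the parametrization `ζ = t·z`, `t ∈ [0,1]`. -/
noncomputable def PhiSol (q : ℕ → ℝ) : ℂ → ℂ := fun z =>
  z * Complex.exp (∫ t in (0 : ℝ)..1,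
    (deriv (qFun q) ((t : ℂ) * z) * ((t : ℂ) * z) + qFun q ((t : ℂ) * z)) /
      (((∑' j, q j : ℝ) : ℂ) - qFun q ((t : ℂ) * z)) / (t : ℂ))

open Filter Topology Metric

theorem norm_qFun_le {q : ℕ → ℝ} (hq0 : q 0 = 0) (hqnn : ∀ j, 0 ≤ q j) (hsum : Summable q)
    {z : ℂ} (hz : ‖z‖ ≤ 1) : ‖qFun q z‖ ≤ (∑' j, q j) * ‖z‖ := by
  refine tsum_of_norm_bounded (hsum.hasSum.mul_right ‖z‖) fun j => ?_
  rw [norm_mul, norm_pow, Complex.norm_real, Real.norm_of_nonneg (hqnn j)]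
  rcases Nat.eq_zero_or_pos j with rfl | hj
  · simp [hq0]
  · exact mul_le_mul_of_nonneg_left (pow_le_of_le_one (norm_nonneg z) hz hj.ne') (hqnn j)

theorem differentiableOn_qFun {q : ℕ → ℝ} (hqnn : ∀ j, 0 ≤ q j) (hsum : Summable q) :
    DifferentiableOn ℂ (qFun q) (ball 0 1) := by
  refine Complex.differentiableOn_tsum_of_summable_norm hsum (fun j => by fun_prop) isOpen_ball
    fun j z hz => ?_
  rw [norm_mul, norm_pow, Complex.norm_real, Real.norm_of_nonneg (hqnn j)]
  exact mul_le_of_le_one_right (hqnn j)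
    (pow_le_one₀ (norm_nonneg z) (mem_ball_zero_iff.1 hz).le)

theorem re_qFun_lt {q : ℕ → ℝ} (hq0 : q 0 = 0) (hqnn : ∀ j, 0 ≤ q j) (hsum : Summable q)
    (hQ1 : 0 < ∑' j, q j) {z : ℂ} (hz : ‖z‖ < 1) : (qFun q z).re < ∑' j, q j :=
  ((Complex.re_le_norm _).trans (norm_qFun_le hq0 hqnn hsum hz.le)).trans_lt
    (mul_lt_of_lt_one_right hQ1 hz)

/-- A holomorphic `K` on the unit disc vanishing at `0` has the radial integrals of
`K ζ / ζ` as a primitive of the holomorphic extension of `K ζ / ζ`. -/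
theorem exists_primitive_eq_radial_integral {K : ℂ → ℂ}
    (hK : DifferentiableOn ℂ K (ball 0 1)) (hK0 : K 0 = 0) :
    ∃ g g' : ℂ → ℂ, g 0 = 0 ∧ (∀ z ∈ ball (0 : ℂ) 1, HasDerivAt g (g' z) z) ∧
      (∀ z ∈ ball (0 : ℂ) 1, ∫ t in (0 : ℝ)..1, K ((t : ℂ) * z) / (t : ℂ) = g z) ∧
      ∀ z, z * g' z = K z := by
  have hslope : ∀ z, z * dslope K 0 z = K z := by
    simpa using sub_smul_dslope_of_zero hK0
  have hd : DifferentiableOn ℂ (dslope K 0) (ball 0 1) :=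
    (Complex.differentiableOn_dslope (ball_mem_nhds 0 one_pos)).2 hK
  obtain ⟨g, hg0, hg⟩ := hd.isExactOn_ball.with_val_at 0 0
  refine ⟨g, dslope K 0, hg0, hg, fun z hz => ?_, hslope⟩
  have hmem : ∀ t ∈ Set.uIcc (0 : ℝ) 1, (t : ℂ) * z ∈ ball (0 : ℂ) 1 := by
    intro t ht
    rw [Set.uIcc_of_le zero_le_one] at ht
    rw [mem_ball_zero_iff] at hz ⊢
    rw [norm_mul, Complex.norm_real, Real.norm_of_nonneg ht.1]
    exact (mul_le_of_le_one_left (norm_nonneg z) ht.2).trans_lt hz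
  have hderiv : ∀ t ∈ Set.uIcc (0 : ℝ) 1,
      HasDerivAt (fun t : ℝ => g ((t : ℂ) * z)) (dslope K 0 ((t : ℂ) * z) * z) t := by
    intro t ht
    have hline : HasDerivAt (fun t : ℝ => (t : ℂ) * z) z t := by
      simpa using (Complex.ofRealCLM.hasDerivAt (x := t)).mul_const z
    exact (hg _ (hmem t ht)).comp t hline
  have hint : IntervalIntegrable (fun t : ℝ => dslope K 0 ((t : ℂ) * z) * z) volume 0 1 :=
    ((hd.continuousOn.comp (by fun_prop) hmem).mul continuousOn_const).intervalIntegrable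
  calc ∫ t in (0 : ℝ)..1, K ((t : ℂ) * z) / (t : ℂ)
      = ∫ t in (0 : ℝ)..1, dslope K 0 ((t : ℂ) * z) * z := by
        refine intervalIntegral.integral_congr_ae (ae_of_all _ fun t ht => ?_)
        rw [Set.uIoc_of_le zero_le_one] at ht
        have ht0 : (t : ℂ) ≠ 0 := Complex.ofReal_ne_zero.2 ht.1.ne'
        rw [← hslope]
        field_simp
    _ = g z := by
        rw [intervalIntegral.integral_eq_sub_of_hasDerivAt hderiv hint]
        simp [hg0]

/-- On the unit disc `PhiSol q = z * exp (g z)` with `g` holomorphic and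
`z * g' z = (q' z * z + q z) / (q(1) - q z)`. -/
theorem exists_phiSol_eq_mul_exp {q : ℕ → ℝ} (hq0 : q 0 = 0) (hqnn : ∀ j, 0 ≤ q j)
    (hsum : Summable q) (hQ1 : 0 < ∑' j, q j) :
    ∃ g g' : ℂ → ℂ, g 0 = 0 ∧ (∀ z ∈ ball (0 : ℂ) 1, HasDerivAt g (g' z) z) ∧
      (∀ z ∈ ball (0 : ℂ) 1, PhiSol q z = z * Complex.exp (g z)) ∧
      ∀ z, z * g' z =
        (deriv (qFun q) z * z + qFun q z) / (((∑' j, q j : ℝ) : ℂ) - qFun q z) := by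
  have hq := differentiableOn_qFun hqnn hsum
  have hqz : qFun q 0 = 0 := by
    simpa using norm_qFun_le hq0 hqnn hsum (z := 0) (by simp)
  have hK : DifferentiableOn ℂ (fun z => (deriv (qFun q) z * z + qFun q z) /
      (((∑' j, q j : ℝ) : ℂ) - qFun q z)) (ball 0 1) := by
    refine (((hq.deriv isOpen_ball).mul differentiableOn_id).add hq).div
      ((differentiableOn_const _).sub hq) fun z hz h => ?_
    have := re_qFun_lt hq0 hqnn hsum hQ1 (mem_ball_zero_iff.1 hz)
    rw [← sub_eq_zero.1 h, Complex.ofReal_re] at this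
    exact this.false
  have hK0 : (fun z => (deriv (qFun q) z * z + qFun q z) /
      (((∑' j, q j : ℝ) : ℂ) - qFun q z)) 0 = 0 := by simp [hqz]
  obtain ⟨g, g', hg0, hg, hgi, hg'⟩ := exists_primitive_eq_radial_integral hK hK0
  refine ⟨g, g', hg0, hg, fun z hz => ?_, hg'⟩
  rw [PhiSol, ← hgi z hz]

/-- Integrating `w * E w` along the spiral `w = z * exp (-a r)`, where `G' w = E w`. -/
theorem integral_Ioi_mul_exp_spiral {E G : ℂ → ℂ}
    (hG : ∀ w ∈ ball (0 : ℂ) 1, HasDerivAt G (E w) w) (hE : ContinuousOn E (ball 0 1))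
    {z a : ℂ} (hz : ‖z‖ < 1) (ha : 0 < a.re) :
    ∫ r : ℝ in Set.Ioi (0 : ℝ), z * Complex.exp (r * -a) * E (z * Complex.exp (r * -a)) =
      (G z - G 0) / a := by
  have ha0 : a ≠ 0 := by rintro rfl; simp at ha
  have hnorm : ∀ r : ℝ, ‖z * Complex.exp (r * -a)‖ = ‖z‖ * Real.exp (-a.re * r) := by
    intro r
    rw [norm_mul, Complex.norm_exp]
    simp [mul_comm]
  have hle : ∀ r : ℝ, 0 ≤ r → ‖z * Complex.exp (r * -a)‖ ≤ ‖z‖ := by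
    intro r hr
    rw [hnorm]
    refine mul_le_of_le_one_right (norm_nonneg z) (Real.exp_le_one_iff.2 ?_)
    nlinarith
  have hmem : ∀ r ∈ Set.Ici (0 : ℝ), z * Complex.exp (r * -a) ∈ ball (0 : ℂ) 1 :=
    fun r hr => mem_ball_zero_iff.2 ((hle r hr).trans_lt hz)
  have hderiv : ∀ r ∈ Set.Ici (0 : ℝ),
      HasDerivAt (fun r : ℝ => -(G (z * Complex.exp (r * -a)) / a))
        (z * Complex.exp (r * -a) * E (z * Complex.exp (r * -a))) r := by
    intro r hr
    have hexp : HasDerivAt (fun r : ℝ => z * Complex.exp (r * -a))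
        (z * (Complex.exp (r * -a) * -a)) r := by
      have hline : HasDerivAt (fun r : ℝ => (r : ℂ) * -a) (-a) r := by
        simpa using (Complex.ofRealCLM.hasDerivAt (x := r)).mul_const (-a)
      exact hline.cexp.const_mul z
    refine (((hG _ (hmem r hr)).comp r hexp).div_const a).neg.congr_deriv ?_
    field_simp
  obtain ⟨M, hM⟩ := (isCompact_closedBall (0 : ℂ) ‖z‖).exists_bound_of_continuousOn
    (hE.mono (closedBall_subset_ball hz))
  have hint : IntegrableOn (fun r : ℝ => z * Complex.exp (r * -a) *
      E (z * Complex.exp (r * -a))) (Set.Ioi 0) := by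
    refine ((exp_neg_integrableOn_Ioi 0 ha).const_mul (‖z‖ * M)).mono' ?_ ?_
    · refine ContinuousOn.aestronglyMeasurable ?_ measurableSet_Ioi
      have hw : ContinuousOn (fun r : ℝ => z * Complex.exp (r * -a)) (Set.Ioi 0) := by fun_prop
      exact hw.mul (hE.comp hw fun r hr => hmem r (Set.Ioi_subset_Ici_self hr))
    · refine (ae_restrict_iff' measurableSet_Ioi).2 (ae_of_all _ fun r hr => ?_)
      rw [norm_mul, hnorm]
      exact mul_le_mul_of_nonneg_left
        (hM _ (mem_closedBall_zero_iff.2 (hle r (le_of_lt hr))))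
        (mul_nonneg (norm_nonneg z) (Real.exp_pos _).le)
        |>.trans_eq (by ring)
  have hw0 : Tendsto (fun r : ℝ => z * Complex.exp (r * -a)) atTop (𝓝 0) := by
    rw [tendsto_zero_iff_norm_tendsto_zero]
    simp_rw [hnorm]
    simpa using (Real.tendsto_exp_atBot.comp
      (tendsto_id.const_mul_atTop_of_neg (neg_neg_of_pos ha))).const_mul ‖z‖
  have hlim : Tendsto (fun r : ℝ => -(G (z * Complex.exp (r * -a)) / a)) atTop
      (𝓝 (-(G 0 / a))) :=
    (((hG 0 (mem_ball_self one_pos)).continuousAt.tendsto.comp hw0).div_const a).neg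
  rw [integral_Ioi_of_hasDerivAt_of_tendsto' hderiv hint hlim]
  simp only [Complex.ofReal_zero, zero_mul, Complex.exp_zero, mul_one]
  ring

/-- Theorem 1 of the paper: with `q` as above, the function `PhiSol q`
is analytic on the open unit disc, satisfies `Φ(0) = 0`, `Φ'(0) = 1`, and solves
`∫_0^∞ Φ(z·exp(r(q(z) − q(1)))) dr = Φ(z)/q(1)` for every `0 < |z| < 1`. -/
theorem phiSol_solves_schroder (q : ℕ → ℝ) (hq0 : q 0 = 0) (hqnn : ∀ j, 0 ≤ q j)
    (hsum : Summable q) (hQ1 : 0 < ∑' j, q j) :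
    AnalyticOnNhd ℂ (PhiSol q) (Metric.ball 0 1) ∧ PhiSol q 0 = 0 ∧
    deriv (PhiSol q) 0 = 1 ∧
    ∀ z : ℂ, z ≠ 0 → ‖z‖ < 1 →
      ∫ r : ℝ in Set.Ioi (0 : ℝ),
          PhiSol q (z * Complex.exp ((r : ℂ) * (qFun q z - ((∑' j, q j : ℝ) : ℂ)))) =
        PhiSol q z / ((∑' j, q j : ℝ) : ℂ) := by
  obtain ⟨g, g', hg0, hg, hPhi, hg'⟩ := exists_phiSol_eq_mul_exp hq0 hqnn hsum hQ1
  have hPhi_deriv : ∀ z ∈ ball (0 : ℂ) 1,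
      HasDerivAt (PhiSol q) (Complex.exp (g z) * (1 + z * g' z)) z := by
    intro z hz
    refine (((hasDerivAt_id z).mul (hg z hz).cexp).congr_of_eventuallyEq ?_).congr_deriv ?_
    · filter_upwards [isOpen_ball.mem_nhds hz] with w hw using hPhi w hw
    · simp only [id]
      ring
  have h0 : (0 : ℂ) ∈ ball (0 : ℂ) 1 := mem_ball_self one_pos
  refine ⟨DifferentiableOn.analyticOnNhd
    (fun z hz => (hPhi_deriv z hz).differentiableAt.differentiableWithinAt) isOpen_ball,
    by simp [PhiSol], by simp [(hPhi_deriv 0 h0).deriv, hg0], fun z _ hz => ?_⟩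
  set c : ℂ := ((∑' j, q j : ℝ) : ℂ) with hc
  have hc0 : c ≠ 0 := Complex.ofReal_ne_zero.2 hQ1.ne'
  have hre : ∀ w ∈ ball (0 : ℂ) 1, 0 < (c - qFun q w).re := by
    intro w hw
    rw [hc, Complex.sub_re, Complex.ofReal_re, sub_pos]
    exact re_qFun_lt hq0 hqnn hsum hQ1 (mem_ball_zero_iff.1 hw)
  have hne : ∀ w ∈ ball (0 : ℂ) 1, c - qFun q w ≠ 0 := by
    intro w hw h
    simpa [h] using hre w hw
  have hz' : z ∈ ball (0 : ℂ) 1 := mem_ball_zero_iff.2 hz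
  have hG : ∀ w ∈ ball (0 : ℂ) 1,
      HasDerivAt (fun w => (c - qFun q w) * PhiSol q w / c) (Complex.exp (g w)) w := by
    intro w hw
    have hqw : HasDerivAt (qFun q) (deriv (qFun q) w) w :=
      ((differentiableOn_qFun hqnn hsum).differentiableAt (isOpen_ball.mem_nhds hw)).hasDerivAt
    refine (((hqw.const_sub c).mul (hPhi_deriv w hw)).div_const c).congr_deriv ?_
    have := hne w hw
    rw [hPhi w hw, hg' w]
    field_simp
    ring
  have hE : ContinuousOn (fun w => Complex.exp (g w)) (ball 0 1) :=
    fun w hw => (hg w hw).cexp.continuousAt.continuousWithinAt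
  have hspiral := integral_Ioi_mul_exp_spiral hG hE hz (hre z hz')
  simp only [neg_sub] at hspiral
  have hcongr : ∫ r : ℝ in Set.Ioi (0 : ℝ),
      PhiSol q (z * Complex.exp ((r : ℂ) * (qFun q z - c))) =
      ∫ r : ℝ in Set.Ioi (0 : ℝ), z * Complex.exp (r * (qFun q z - c)) *
        Complex.exp (g (z * Complex.exp (r * (qFun q z - c)))) := by
    refine setIntegral_congr_fun measurableSet_Ioi fun r hr => hPhi _ ?_
    have hr0 : (0 : ℝ) < r := hr
    have hzre := hre z hz'
    rw [← neg_sub (qFun q z) c, Complex.neg_re] at hzre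
    rw [mem_ball_zero_iff, norm_mul, Complex.norm_exp, Complex.re_ofReal_mul]
    refine (mul_le_of_le_one_right (norm_nonneg z) (Real.exp_le_one_iff.2 ?_)).trans_lt hz
    nlinarith
  have hPhi0 : PhiSol q 0 = 0 := by simp [PhiSol]
  rw [hcongr, hspiral, hPhi0]
  have := hne z hz'
  field_simp
  simp
end

section
/- Let q be a polynomial of degree N ≥ 1 with nonnegative coefficients and q(0) = 0, and suppose the equation q(z) = q(1) has N distinct complex roots b_1, …, b_N. Then q'(b_j) ≠ 0 and b_j ≠ 0 for each j, and for every complex ζ not in {0, b_1, …, b_N} one has the partial fraction decomposition (q'(ζ)ζ + q(ζ)) / ((q(1) − q(ζ))ζ) = Σ_{j=1}^N (1 + q(1)/(q'(b_j) b_j)) / (b_j − ζ). -/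
open Polynomial

/-- A polynomial whose degree equals the number of its given distinct roots is its leading
coefficient times the nodal polynomial of these roots. -/
theorem eq_C_leadingCoeff_mul_nodal {F ι : Type*} [Field F] [Fintype ι] {P : F[X]} {b : ι → F}
    (hb : Function.Injective b) (hP : P.degree = Fintype.card ι)
    (hroot : ∀ j, P.eval (b j) = 0) :
    P = C P.leadingCoeff * Lagrange.nodal Finset.univ b := by
  have hP0 : P ≠ 0 := by
    rintro rfl
    simp at hP
  have hlc : P.leadingCoeff ≠ 0 := leadingCoeff_ne_zero.mpr hP0
  refine eq_of_degree_le_of_eval_index_eq Finset.univ hb.injOn ?_ ?_ ?_ fun j hj => ?_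
  · rw [hP, Finset.card_univ]
  · rw [degree_C_mul hlc, Lagrange.degree_nodal, hP, Finset.card_univ]
  · rw [leadingCoeff_mul, leadingCoeff_C, Lagrange.nodal_monic.leadingCoeff, mul_one]
  · rw [hroot, eval_mul, Lagrange.eval_nodal_at_node hj, mul_zero]

theorem eval_derivative_ne_zero_of_injective_roots {F ι : Type*} [Field F] [Fintype ι]
    {P : F[X]} {b : ι → F} (hb : Function.Injective b) (hP : P.degree = Fintype.card ι)
    (hroot : ∀ j, P.eval (b j) = 0) (j : ι) : P.derivative.eval (b j) ≠ 0 := by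
  classical
  have hP0 : P ≠ 0 := by
    rintro rfl
    simp at hP
  have hw := Lagrange.nodalWeight_ne_zero hb.injOn (Finset.mem_univ j)
  rw [Lagrange.nodalWeight_eq_eval_derivative_nodal (Finset.mem_univ j)] at hw
  rw [eq_C_leadingCoeff_mul_nodal hb hP hroot, derivative_C_mul, eval_C_mul]
  exact mul_ne_zero (leadingCoeff_ne_zero.mpr hP0) fun h => hw (by rw [h, inv_zero])

/-- Partial fraction decomposition of `G / P` when `P` has simple roots `b j`. -/
theorem eval_div_eval_eq_sum_of_injective_roots {F ι : Type*} [Field F] [Fintype ι]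
    {P G : F[X]} {b : ι → F} (hb : Function.Injective b) (hP : P.degree = Fintype.card ι)
    (hroot : ∀ j, P.eval (b j) = 0) (hG : G.degree < Fintype.card ι) {x : F}
    (hx : ∀ j, x ≠ b j) :
    G.eval x / P.eval x =
      ∑ j, G.eval (b j) / P.derivative.eval (b j) / (x - b j) := by
  classical
  have hnodal : (Lagrange.nodal Finset.univ b).eval x ≠ 0 :=
    Lagrange.eval_nodal_not_at_node fun j _ => hx j
  have hGx : G.eval x = (Lagrange.nodal Finset.univ b).eval x *
      ∑ j, Lagrange.nodalWeight Finset.univ b j * (x - b j)⁻¹ * G.eval (b j) := by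
    rw [← Lagrange.eval_interpolate_not_at_node _ fun j _ => hx j,
      ← Lagrange.eq_interpolate hb.injOn (by rwa [Finset.card_univ])]
  have hPa := eq_C_leadingCoeff_mul_nodal hb hP hroot
  generalize P.leadingCoeff = a at hPa
  rw [hPa, hGx, eval_C_mul, mul_comm a, mul_div_mul_left _ _ hnodal, Finset.sum_div]
  refine Finset.sum_congr rfl fun j hj => ?_
  rw [Lagrange.nodalWeight_eq_eval_derivative_nodal hj, derivative_C_mul, eval_C_mul]
  simp only [div_eq_mul_inv, mul_inv]
  ring

theorem eval_one_pos_of_coeff_nonneg {q : ℝ[X]} (hq : q ≠ 0) (hcoeff : ∀ i, 0 ≤ q.coeff i) :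
    0 < q.eval 1 := by
  rw [eval_eq_sum_range]
  refine Finset.sum_pos' (fun i _ => by simpa using hcoeff i)
    ⟨q.natDegree, Finset.self_mem_range_succ _, ?_⟩
  simpa using lt_of_le_of_ne (hcoeff _) (leadingCoeff_ne_zero.mpr hq).symm

/-- partial fraction decomposition, Corollary 1 ingredient: for a
polynomial `q` of degree `N ≥ 1` with nonnegative coefficients and `q(0) = 0`, whose
equation `q(z) = q(1)` has `N` distinct complex roots `b_1, …, b_N`, one has
`q'(b_j) ≠ 0`, `b_j ≠ 0`, and for `ζ ∉ {0, b_1, …, b_N}`,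
`(q'(ζ)ζ + q(ζ))/((q(1) − q(ζ))ζ) = Σ_j (1 + q(1)/(q'(b_j)b_j))/(b_j − ζ)`. -/
theorem partial_fraction_decomposition (N : ℕ) (hN : 1 ≤ N) (q : Polynomial ℝ)
    (hdeg : q.natDegree = N) (hcoeff : ∀ i, 0 ≤ q.coeff i) (hq0 : q.coeff 0 = 0)
    (b : Fin N → ℂ) (hb : Function.Injective b)
    (hroot : ∀ j, Polynomial.aeval (b j) q = ((q.eval 1 : ℝ) : ℂ)) :
    (∀ j, Polynomial.aeval (b j) q.derivative ≠ 0 ∧ b j ≠ 0) ∧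
    ∀ ζ : ℂ, ζ ≠ 0 → (∀ j, ζ ≠ b j) →
      (Polynomial.aeval ζ q.derivative * ζ + Polynomial.aeval ζ q) /
          ((((q.eval 1 : ℝ) : ℂ) - Polynomial.aeval ζ q) * ζ) =
        ∑ j, (1 + ((q.eval 1 : ℝ) : ℂ) / (Polynomial.aeval (b j) q.derivative * b j)) /
          (b j - ζ) := by
  have hq : q ≠ 0 := by
    rintro rfl
    simp at hdeg
    omega
  have hc : ((q.eval 1 : ℝ) : ℂ) ≠ 0 :=
    Complex.ofReal_ne_zero.mpr (eval_one_pos_of_coeff_nonneg hq hcoeff).ne'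
  generalize ((q.eval 1 : ℝ) : ℂ) = c at hroot hc ⊢
  obtain ⟨r, rfl⟩ := X_dvd_iff.mpr hq0
  have hr : r ≠ 0 := right_ne_zero_of_mul hq
  set R : ℂ[X] := r.map (algebraMap ℝ ℂ) with hR
  set Q : ℂ[X] := X * R with hQ
  have hmap : (X * r).map (algebraMap ℝ ℂ) = Q := by simp [hQ, hR]
  have hQeval (z : ℂ) : aeval z (X * r) = z * R.eval z := by
    rw [← eval_map_algebraMap, hmap, hQ, eval_mul, eval_X]
  have hQderiv (z : ℂ) : aeval z (derivative (X * r)) = Q.derivative.eval z := by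
    rw [← eval_map_algebraMap, ← derivative_map, hmap]
  simp only [hQeval] at hroot
  simp only [hQeval, hQderiv]
  have hQdeg : Q.degree = N := by
    rw [← hmap, degree_map, degree_eq_natDegree hq, hdeg]
  have hRdeg : R.degree < N := by
    rw [← hQdeg, hQ, mul_comm]
    exact degree_lt_degree_mul_X ((Polynomial.map_ne_zero_iff (algebraMap ℝ ℂ).injective).mpr hr)
  have hQ0 : Q ≠ 0 := by
    rintro h
    simp [h] at hQdeg
  have hGdeg : (Q.derivative + R).degree < Fintype.card (Fin N) := by
    rw [Fintype.card_fin]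
    exact (degree_add_le _ _).trans_lt (max_lt (hQdeg ▸ degree_derivative_lt hQ0) hRdeg)
  have hPdeg : (Q - C c).degree = Fintype.card (Fin N) := by
    rw [Fintype.card_fin, degree_sub_C, hQdeg]
    rw [hQdeg]
    exact_mod_cast hN
  have hProot (j : Fin N) : (Q - C c).eval (b j) = 0 := by
    simp [hQ, hroot]
  have hderiv (j : Fin N) : Q.derivative.eval (b j) ≠ 0 := by
    simpa using eval_derivative_ne_zero_of_injective_roots hb hPdeg hProot j
  have hbne (j : Fin N) : b j ≠ 0 := by
    intro h
    apply hc
    rw [← hroot j, h, zero_mul]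
  refine ⟨fun j => ⟨hderiv j, hbne j⟩, fun ζ hζ hζb => ?_⟩
  have key := eval_div_eval_eq_sum_of_injective_roots hb hPdeg hProot hGdeg hζb
  simp only [derivative_sub, derivative_C, sub_zero, eval_add, eval_sub, eval_C] at key
  have hQζ : Q.eval ζ = ζ * R.eval ζ := by rw [hQ, eval_mul, eval_X]
  calc _ = -((Q.derivative.eval ζ + R.eval ζ) / (Q.eval ζ - c)) := by
        rw [hQζ, ← div_neg, neg_sub, mul_comm ζ (R.eval ζ), ← add_mul, mul_div_mul_right _ _ hζ]
    _ = _ := by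
        rw [key, ← Finset.sum_neg_distrib]
        refine Finset.sum_congr rfl fun j _ => ?_
        have hRb : R.eval (b j) = c / b j := by
          rw [← hroot j, mul_div_cancel_left₀ _ (hbne j)]
        rw [hRb, ← div_neg, neg_sub, add_div, div_self (hderiv j), div_div,
          mul_comm (b j)]
end

section
/- Let q be a polynomial of degree N ≥ 1 with nonnegative coefficients and q(0) = 0, whose equation q(z) = q(1) has N distinct complex roots b_1, …, b_N with b_1 = 1 and |b_j| > 1 for all j ≥ 2, and let φ_n be the n-th Taylor coefficient at 0 of Φ(z) := z·∏_{j=1}^N (1 − z/b_j)^{−1 − q(1)/(q'(b_j) b_j)} (principal branches). Set β := q(1)/q'(1) and C := (1/Γ(1 + β))·∏_{j=2}^N (1 − 1/b_j)^{−1 − q(1)/(q'(b_j) b_j)}. Then φ_n / n^β → C as n → ∞. -/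
open Polynomial Filter

/-- The closed-form solution `Φ(z) = z·∏_j (1 − z/b_j)^(−1 − q(1)/(q'(b_j)b_j))`
(principal-branch complex powers) of Corollary 1. -/
noncomputable def PhiProd (N : ℕ) (q : Polynomial ℝ) (b : Fin N → ℂ) : ℂ → ℂ :=
  fun z => z * ∏ j, (1 - z / b j) ^
    (-1 - ((q.eval 1 : ℝ) : ℂ) / (Polynomial.aeval (b j) q.derivative * b j))

/-- The coefficients of `(1 - z) ^ (-1 - β)`. -/
noncomputable def negBinomCoeff (β : ℝ) (n : ℕ) : ℝ :=
  (ascPochhammer ℝ n).eval (1 + β) / n.factorial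

theorem negBinomCoeff_succ (β : ℝ) (n : ℕ) :
    negBinomCoeff β (n + 1) = negBinomCoeff β n * ((1 + β + n) / (n + 1)) := by
  simp only [negBinomCoeff, ascPochhammer_succ_eval, Nat.factorial_succ]
  push_cast
  field_simp

theorem negBinomCoeff_pos {β : ℝ} (hβ : 0 < β) (n : ℕ) : 0 < negBinomCoeff β n :=
  div_pos (ascPochhammer_pos n _ (by positivity)) (by positivity)

theorem monotone_negBinomCoeff {β : ℝ} (hβ : 0 < β) : Monotone (negBinomCoeff β) := by
  refine monotone_nat_of_le_succ fun n => ?_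
  rw [negBinomCoeff_succ]
  refine le_mul_of_one_le_right (negBinomCoeff_pos hβ n).le ?_
  rw [one_le_div (by positivity)]
  linarith

theorem iteratedDeriv_one_sub_cpow (β : ℝ) (n : ℕ) :
    iteratedDeriv n (fun z : ℂ => (1 - z) ^ (-1 - (β : ℂ))) 0 / (n.factorial : ℂ) =
      (negBinomCoeff β n : ℂ) := by
  have hfun : (fun z : ℂ => (1 - z) ^ (-1 - (β : ℂ))) =
      fun z : ℂ => 1 / (1 - z) ^ (1 + (β : ℂ)) := by
    funext z
    rw [one_div, ← Complex.cpow_neg]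
    ring_nf
  have h := (Complex.one_div_one_sub_cpow_hasFPowerSeriesOnBall_zero
    (1 + (β : ℂ))).factorial_smul 1 n
  rw [hfun, iteratedDeriv_eq_iteratedFDeriv, ← h]
  simp only [FormalMultilinearSeries.ofScalars_apply_eq, one_pow, smul_eq_mul, mul_one]
  rw [← Ring.multichoose_eq, Ring.factorial_nsmul_multichoose_eq_ascPochhammer,
    Polynomial.ascPochhammer_smeval_eq_eval, negBinomCoeff]
  push_cast
  congr 1
  have := Polynomial.eval₂_hom (p := ascPochhammer ℝ n) Complex.ofRealHom (1 + β)
  rw [← Polynomial.eval_map, ascPochhammer_map] at this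
  simpa using this

theorem tendsto_negBinomCoeff_div_rpow {β : ℝ} (hβ : 0 < β) :
    Tendsto (fun n : ℕ => negBinomCoeff β n / (n : ℝ) ^ β) atTop
      (nhds (Real.Gamma (1 + β))⁻¹) := by
  have hprod : ∀ n : ℕ, ∏ j ∈ Finset.range (n + 1), (β + j) =
      β * (ascPochhammer ℝ n).eval (1 + β) := by
    intro n
    induction n with
    | zero => simp
    | succ n ih =>
      rw [Finset.prod_range_succ, ih, ascPochhammer_succ_eval]
      push_cast
      ring
  have h := ((Real.GammaSeq_tendsto_Gamma β).const_mul β).inv₀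
    (mul_ne_zero hβ.ne' (Real.Gamma_pos_of_pos hβ).ne')
  rw [add_comm 1 β, Real.Gamma_add_one hβ.ne']
  refine h.congr fun n => ?_
  rw [Real.GammaSeq, hprod, negBinomCoeff]
  field_simp

theorem tendsto_negBinomCoeff_sub_div_rpow {β : ℝ} (hβ : 0 < β) (k : ℕ) :
    Tendsto (fun n : ℕ => negBinomCoeff β (n - k) / (n : ℝ) ^ β) atTop
      (nhds (Real.Gamma (1 + β))⁻¹) := by
  have h1 := (tendsto_negBinomCoeff_div_rpow hβ).comp (tendsto_sub_atTop_nat k)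
  have h2 : Tendsto (fun n : ℕ => 1 - (k : ℝ) / n) atTop (nhds (1 - 0)) :=
    tendsto_const_nhds.sub (tendsto_const_div_atTop_nhds_zero_nat (k : ℝ))
  rw [sub_zero] at h2
  have h3 := h1.mul (h2.rpow_const (p := β) (Or.inl one_ne_zero))
  rw [Real.one_rpow, mul_one] at h3
  refine h3.congr' ?_
  filter_upwards [eventually_gt_atTop k] with n hn
  have hk : (0 : ℝ) < ((n - k : ℕ) : ℝ) := by exact_mod_cast Nat.sub_pos_of_lt hn
  have hn0 : (0 : ℝ) < n := by exact_mod_cast (Nat.zero_le k).trans_lt hn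
  have he : 1 - (k : ℝ) / n = ((n - k : ℕ) : ℝ) / n := by
    rw [Nat.cast_sub hn.le]
    field_simp
  have := Real.rpow_pos_of_pos hk β
  simp only [Function.comp_apply]
  rw [he, Real.div_rpow hk.le hn0.le]
  field_simp

theorem tendsto_sum_mul_negBinomCoeff {β : ℝ} (hβ : 0 < β) {f : ℕ → ℂ} {s : ℂ}
    (hf : HasSum f s) :
    Tendsto (fun n : ℕ => (∑ k ∈ Finset.range (n + 1), f k * (negBinomCoeff β (n - k) : ℂ)) /
        (((n : ℝ) ^ β : ℝ) : ℂ)) atTop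
      (nhds ((Real.Gamma (1 + β) : ℂ)⁻¹ * s)) := by
  obtain ⟨K, hK⟩ := (tendsto_negBinomCoeff_div_rpow hβ).bddAbove_range
  let F : ℕ → ℕ → ℂ := fun n k =>
    if k ∈ Finset.range (n + 1) then
      f k * ((negBinomCoeff β (n - k) / (n : ℝ) ^ β : ℝ) : ℂ) else 0
  have hlim : Tendsto (fun n => ∑' k, F n k) atTop
      (nhds (∑' k, f k * ((Real.Gamma (1 + β))⁻¹ : ℝ))) := by
    refine tendsto_tsum_of_dominated_convergence (bound := fun k => ‖f k‖ * K)
      (hf.summable.norm.mul_right K) (fun k => ?_) (Eventually.of_forall fun n k => ?_)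
    · refine Tendsto.congr' ?_ (((Complex.continuous_ofReal.tendsto _).comp
        (tendsto_negBinomCoeff_sub_div_rpow hβ k)).const_mul (f k))
      filter_upwards [eventually_ge_atTop k] with n hn
      simp [F, hn.not_gt]
    · have h0 : ∀ m : ℕ, 0 ≤ negBinomCoeff β m / (n : ℝ) ^ β := fun m =>
        div_nonneg (negBinomCoeff_pos hβ m).le (by positivity)
      have hle : negBinomCoeff β (n - k) / (n : ℝ) ^ β ≤ K :=
        (div_le_div_of_nonneg_right (monotone_negBinomCoeff hβ (Nat.sub_le n k))
          (by positivity)).trans (hK ⟨n, rfl⟩)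
      simp only [F]
      split_ifs
      · rw [norm_mul, Complex.norm_real, Real.norm_of_nonneg (h0 _)]
        exact mul_le_mul_of_nonneg_left hle (norm_nonneg _)
      · simpa using mul_nonneg (norm_nonneg (f k)) ((h0 _).trans hle)
  rw [tsum_mul_right, hf.tsum_eq, mul_comm, Complex.ofReal_inv] at hlim
  refine hlim.congr fun n => ?_
  rw [tsum_eq_sum (s := Finset.range (n + 1)) fun k hk => if_neg hk, Finset.sum_div]
  refine Finset.sum_congr rfl fun k hk => ?_
  simp only [if_pos hk]
  push_cast
  ring

/-- Transfer theorem for a function `f z * (1 - z) ^ (-1 - β)` with `f` holomorphic on a disc of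
radius larger than `1`. -/
theorem tendsto_coeff_mul_one_sub_cpow {β : ℝ} (hβ : 0 < β) {f : ℂ → ℂ} {r : ℝ} (hr : 1 < r)
    (hf : DifferentiableOn ℂ f (Metric.ball 0 r)) :
    Tendsto (fun n : ℕ =>
        (iteratedDeriv n (fun z => f z * (1 - z) ^ (-1 - (β : ℂ))) 0 / (n.factorial : ℂ)) /
          (((n : ℝ) ^ β : ℝ) : ℂ)) atTop
      (nhds ((Real.Gamma (1 + β) : ℂ)⁻¹ * f 1)) := by
  have hsum := Complex.hasSum_taylorSeries_on_ball hf (z := 1) (by simpa using hr)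
  refine (tendsto_sum_mul_negBinomCoeff hβ hsum).congr fun n => ?_
  have hfa : AnalyticAt ℂ f 0 := hf.analyticAt (Metric.ball_mem_nhds 0 (by linarith))
  have hga : AnalyticAt ℂ (fun z : ℂ => (1 - z) ^ (-1 - (β : ℂ))) 0 :=
    (analyticAt_const.sub analyticAt_id).cpow analyticAt_const (by simp)
  rw [iteratedDeriv_fun_mul hfa.contDiffAt hga.contDiffAt, Finset.sum_div _ _ (n.factorial : ℂ)]
  congr 1
  refine Finset.sum_congr rfl fun k hk => ?_
  have hkn : k ≤ n := Nat.lt_succ_iff.mp (Finset.mem_range.mp hk)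
  rw [← iteratedDeriv_one_sub_cpow, Nat.cast_choose ℂ hkn]
  have h1 : (n.factorial : ℂ) ≠ 0 := by exact_mod_cast n.factorial_ne_zero
  simp only [sub_zero, one_pow, smul_eq_mul]
  field_simp

theorem one_sub_div_mem_slitPlane {z b : ℂ} (h : ‖z‖ < ‖b‖) :
    1 - z / b ∈ Complex.slitPlane := by
  refine Or.inl ?_
  have h1 : ‖z / b‖ < 1 := by
    rw [norm_div]
    exact (div_lt_one ((norm_nonneg z).trans_lt h)).mpr h
  have h2 := (Complex.re_le_norm (z / b)).trans_lt h1
  simpa using h2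

theorem eval_one_pos_of_coeff_nonneg_s8 {p : Polynomial ℝ} (hp : p ≠ 0)
    (hcoeff : ∀ i, 0 ≤ p.coeff i) : 0 < p.eval 1 := by
  rw [Polynomial.eval_eq_sum, Polynomial.sum]
  refine Finset.sum_pos (fun i hi => ?_) (Polynomial.nonempty_support_iff.mpr hp)
  simpa using (hcoeff i).lt_of_ne' (Polynomial.mem_support_iff.mp hi)

/-- Corollary 2, leading asymptotics: with `q`, `b` as in Corollary 1 and
moreover `b_1 = 1` (root of index `j0`) and `|b_j| > 1` for the remaining roots, the
Taylor coefficients `φ_n` of `Φ` satisfy `φ_n / n^β → C` as `n → ∞`, where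
`β = q(1)/q'(1)` and
`C = Γ(1 + β)⁻¹ · ∏_{j ≠ j0} (1 − 1/b_j)^(−1 − q(1)/(q'(b_j)b_j))`. -/
theorem phiProd_coeff_asymptotics (N : ℕ) (hN : 1 ≤ N) (q : Polynomial ℝ)
    (hdeg : q.natDegree = N) (hcoeff : ∀ i, 0 ≤ q.coeff i) (hq0 : q.coeff 0 = 0)
    (b : Fin N → ℂ) (hb : Function.Injective b)
    (hroot : ∀ j, Polynomial.aeval (b j) q = ((q.eval 1 : ℝ) : ℂ))
    (j0 : Fin N) (hb1 : b j0 = 1) (hbig : ∀ j, j ≠ j0 → 1 < ‖b j‖) :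
    Tendsto
      (fun n : ℕ => (iteratedDeriv n (PhiProd N q b) 0 / (n.factorial : ℂ)) /
        (((n : ℝ) ^ (q.eval 1 / q.derivative.eval 1) : ℝ) : ℂ))
      atTop
      (nhds ((Complex.Gamma (1 + ((q.eval 1 / q.derivative.eval 1 : ℝ) : ℂ)))⁻¹ *
        ∏ j ∈ Finset.univ.erase j0, (1 - 1 / b j) ^
          (-1 - ((q.eval 1 : ℝ) : ℂ) / (Polynomial.aeval (b j) q.derivative * b j)))) := by
  have hq : 0 < q.eval 1 := eval_one_pos_of_coeff_nonneg_s8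
    (by rintro rfl; simp at hdeg; omega) hcoeff
  have hq' : 0 < q.derivative.eval 1 := by
    refine eval_one_pos_of_coeff_nonneg_s8 (fun h => ?_) fun i => ?_
    · have := Polynomial.derivative_eq_zero.mp h
      omega
    · rw [Polynomial.coeff_derivative]
      exact mul_nonneg (hcoeff _) (by positivity)
  have hβ : 0 < q.eval 1 / q.derivative.eval 1 := div_pos hq hq'
  obtain ⟨r, hr, hr1⟩ : ∃ r : ℝ, (∀ j, j ≠ j0 → r < ‖b j‖) ∧ 1 < r := by
    have h : ∀ᶠ r : ℝ in nhdsWithin 1 (Set.Ioi 1), ∀ j, j ≠ j0 → r < ‖b j‖ :=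
      eventually_all.mpr fun j => eventually_imp_distrib_left.mpr fun hj =>
        nhdsWithin_le_nhds (Iio_mem_nhds (hbig j hj))
    exact (h.and self_mem_nhdsWithin).exists
  set f : ℂ → ℂ := fun z => z * ∏ j ∈ Finset.univ.erase j0, (1 - z / b j) ^
    (-1 - ((q.eval 1 : ℝ) : ℂ) / (Polynomial.aeval (b j) q.derivative * b j)) with hf
  have hfd : DifferentiableOn ℂ f (Metric.ball 0 r) := by
    refine differentiableOn_id.mul (DifferentiableOn.fun_finsetProd fun j hj => ?_)
    intro z hz
    have hzb : ‖z‖ < ‖b j‖ :=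
      (mem_ball_zero_iff.mp hz).trans (hr j (Finset.ne_of_mem_erase hj))
    have hd : DifferentiableAt ℂ (fun z : ℂ => 1 - z / b j) z := by fun_prop
    exact (hd.cpow (differentiableAt_const _)
      (one_sub_div_mem_slitPlane hzb)).differentiableWithinAt
  have haeval : Polynomial.aeval (1 : ℂ) q.derivative = ((q.derivative.eval 1 : ℝ) : ℂ) := by
    simpa using Polynomial.aeval_algebraMap_apply ℂ (1 : ℝ) q.derivative
  have hPhi : PhiProd N q b =
      fun z => f z * (1 - z) ^ (-1 - ((q.eval 1 / q.derivative.eval 1 : ℝ) : ℂ)) := by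
    funext z
    rw [PhiProd, ← Finset.prod_erase_mul _ _ (Finset.mem_univ j0), hb1, haeval]
    simp only [hf, div_one, mul_one, Complex.ofReal_div, mul_assoc]
  have hlim := tendsto_coeff_mul_one_sub_cpow hβ hr1 hfd
  rw [← hPhi, ← Complex.Gamma_ofReal, Complex.ofReal_add, Complex.ofReal_one] at hlim
  simpa only [hf, one_mul] using hlim
end

section
/- Let q be a polynomial of degree N ≥ 1 with nonnegative coefficients and q(0) = 0, whose equation q(z) = q(1) has N distinct complex roots b_1, …, b_N with b_1 = 1 and |b_j| > 1 for all j ≥ 2. Set β := q(1)/q'(1) and define G(z) := z·∏_{j=2}^N (1 − z/b_j)^{−1 − q(1)/(q'(b_j) b_j)} (principal branches), which is analytic in a neighborhood of z = 1 with G(1) ≠ 0. Then −G'(1)/G(1) = ((q'(1) − q(1))·q''(1) − 2·q(1)·q'(1)) / (2·q'(1)^2); equivalently, in the expansion Φ(z)·(1 − z)^{1+β} = G(1)(1 + A_1(1 − z) + O((1 − z)^2)) at z = 1 of Φ(z) := (1 − z)^{−1−β} G(z), the coefficient A_1 equals ((q'(1) − q(1))q''(1) − 2q(1)q'(1)) /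 (2q'(1)^2). -/
open Polynomial

/-- The regular factor `G(z) = z·∏_{j ≠ j0} (1 − z/b_j)^(−1 − q(1)/(q'(b_j)b_j))`
(principal-branch complex powers) of the closed-form solution, the singular root
`b_{j0} = 1` being removed. -/
noncomputable def Gfac (N : ℕ) (q : Polynomial ℝ) (b : Fin N → ℂ) (j0 : Fin N) : ℂ → ℂ :=
  fun z => z * ∏ j ∈ Finset.univ.erase j0, (1 - z / b j) ^
    (-1 - ((q.eval 1 : ℝ) : ℂ) / (Polynomial.aeval (b j) q.derivative * b j))

namespace Lagrange

variable {F ι : Type*} [Field F] [DecidableEq ι] {s : Finset ι} {v : ι → F} {i : ι}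

lemma eval_nodal_erase (hi : i ∈ s) {x : F} (hx : x ≠ v i) :
    (nodal (s.erase i) v).eval x = (nodal s v).eval x * (x - v i)⁻¹ := by
  rw [nodal_eq_mul_nodal_erase hi, eval_mul, eval_sub, eval_X, eval_C]
  have := sub_ne_zero.2 hx
  field_simp

lemma eval_derivative_nodal_erase (hi : i ∈ s) {j : ι} (hj : j ∈ s) (hij : v i ≠ v j) :
    (nodal (s.erase j) v).derivative.eval (v i) =
      (nodal s v).derivative.eval (v i) * (v i - v j)⁻¹ := by
  have h : (nodal (s.erase j) v).eval (v i) = 0 := by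
    rw [eval_nodal_erase hj hij, eval_nodal_at_node hi, zero_mul]
  have := sub_ne_zero.2 hij
  rw [nodal_eq_mul_nodal_erase hj]
  simp only [derivative_mul, derivative_sub, derivative_X, derivative_C, eval_add, eval_mul,
    eval_sub, eval_X, eval_C, sub_zero, eval_one, h]
  field_simp
  ring

lemma eval_derivative_nodal_erase_self (hvs : Set.InjOn v s) (hi : i ∈ s) :
    (nodal (s.erase i) v).derivative.eval (v i) =
      (nodal s v).derivative.eval (v i) * ∑ j ∈ s.erase i, (v i - v j)⁻¹ := by
  rw [derivative_nodal, eval_finsetSum, Finset.mul_sum, eval_nodal_derivative_eval_node_eq hi]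
  refine Finset.sum_congr rfl fun j hj => eval_nodal_erase hj fun h => ?_
  exact (Finset.mem_erase.1 hj).1 (hvs (Finset.mem_of_mem_erase hj) hi h.symm)

lemma eval_derivative_derivative_nodal (hvs : Set.InjOn v s) (hi : i ∈ s) :
    (nodal s v).derivative.derivative.eval (v i) =
      2 * (nodal s v).derivative.eval (v i) * ∑ j ∈ s.erase i, (v i - v j)⁻¹ := by
  rw [mul_assoc, ← eval_derivative_nodal_erase_self hvs hi, nodal_eq_mul_nodal_erase hi]
  simp only [derivative_mul, derivative_add, derivative_sub, derivative_X, derivative_C, eval_add,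
    eval_mul, eval_sub, eval_X, eval_C, sub_zero, sub_self, one_mul]
  ring

lemma eval_derivative_nodal_ne_zero (hvs : Set.InjOn v s) (hi : i ∈ s) :
    (nodal s v).derivative.eval (v i) ≠ 0 := by
  have h := nodalWeight_ne_zero hvs hi
  rw [nodalWeight_eq_eval_derivative_nodal hi] at h
  exact fun h0 => h (by rw [h0, inv_zero])

lemma basis_eq_mul_nodal_erase (hi : i ∈ s) :
    Lagrange.basis s v i = C ((nodal s v).derivative.eval (v i))⁻¹ * nodal (s.erase i) v := by
  rw [basis_eq_prod_sub_inv_mul_nodal_div hi, nodalWeight_eq_eval_derivative_nodal hi,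
    nodal_erase_eq_nodal_div hi]

/-- The partial fraction expansion of `1 / nodal s v`. -/
lemma eval_nodal_mul_sum (hvs : Set.InjOn v s) (hs : s.Nonempty) {x : F}
    (hx : ∀ j ∈ s, x ≠ v j) :
    (nodal s v).eval x * ∑ j ∈ s, ((nodal s v).derivative.eval (v j))⁻¹ * (x - v j)⁻¹ = 1 := by
  have h := congrArg (eval x) (sum_basis hvs hs)
  rw [eval_finsetSum, eval_one] at h
  rw [← h, Finset.mul_sum]
  refine Finset.sum_congr rfl fun j hj => ?_
  rw [eval_basis_not_at_node hj (hx j hj), nodalWeight_eq_eval_derivative_nodal hj]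

/-- The constant term at the node `v i` of the partial fraction expansion of `1 / nodal s v`. -/
lemma eval_derivative_nodal_mul_sum (hvs : Set.InjOn v s) (hi : i ∈ s) :
    (nodal s v).derivative.eval (v i) *
      ∑ j ∈ s.erase i, ((nodal s v).derivative.eval (v j))⁻¹ * (v i - v j)⁻¹ =
    -∑ j ∈ s.erase i, (v i - v j)⁻¹ := by
  have h := congrArg (fun p => eval (v i) (derivative p)) (sum_basis hvs ⟨i, hi⟩)
  simp only [derivative_sum, eval_finsetSum, derivative_one, eval_zero] at h
  rw [← Finset.add_sum_erase _ _ hi, basis_eq_mul_nodal_erase hi, derivative_C_mul, eval_mul,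
    eval_C, eval_derivative_nodal_erase_self hvs hi,
    inv_mul_cancel_left₀ (eval_derivative_nodal_ne_zero hvs hi)] at h
  rw [← sub_eq_zero, sub_neg_eq_add, add_comm, ← h, Finset.mul_sum]
  congr 1
  refine Finset.sum_congr rfl fun j hj => ?_
  have hj' := Finset.mem_of_mem_erase hj
  rw [basis_eq_mul_nodal_erase hj', derivative_C_mul, eval_mul, eval_C,
    eval_derivative_nodal_erase hi hj'
      fun h => (Finset.mem_erase.1 hj).1 (hvs hj' hi h.symm)]
  ring

end Lagrange

/-- A polynomial taking the value `a` at as many points as its degree is determined by them. -/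
lemma Polynomial.eq_C_mul_nodal_add_C {F ι : Type*} [Field F] {s : Finset ι} {v : ι → F}
    (hvs : Set.InjOn v s) (p : F[X]) (a : F) (hp : 0 < p.natDegree) (hs : s.card = p.natDegree)
    (h : ∀ j ∈ s, p.eval (v j) = a) :
    p = C p.leadingCoeff * Lagrange.nodal s v + C a := by
  have hp0 : p.leadingCoeff ≠ 0 := leadingCoeff_ne_zero.2 (ne_zero_of_natDegree_gt hp)
  have hlt : (C a : F[X]).degree < p.degree :=
    degree_C_le.trans_lt (natDegree_pos_iff_degree_pos.1 hp)
  have hdeg : (p - C a).degree = s.card := by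
    rw [degree_sub_eq_left_of_degree_lt hlt, hs]
    exact degree_eq_natDegree (ne_zero_of_natDegree_gt hp)
  rw [← sub_eq_iff_eq_add]
  refine eq_of_degree_le_of_eval_index_eq s hvs hdeg.le ?_ ?_ ?_
  · rw [hdeg, degree_C_mul hp0, Lagrange.degree_nodal]
  · rw [leadingCoeff_sub_of_degree_lt hlt, leadingCoeff_mul, leadingCoeff_C,
      Lagrange.nodal_monic.leadingCoeff, mul_one]
  · intro j hj
    simp [h j hj, Lagrange.eval_nodal_at_node hj]

lemma Complex.one_sub_div_mem_slitPlane {w : ℂ} (hw : 1 < ‖w‖) : 1 - 1 / w ∈ slitPlane := by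
  rw [sub_eq_add_neg]
  refine mem_slitPlane_of_norm_lt_one ?_
  rw [norm_neg, norm_div, norm_one]
  exact (div_lt_one (by positivity)).2 hw

/-- The logarithmic derivative at `1` of the factor `(1 - z / w) ^ e`. -/
lemma Complex.logDeriv_one_sub_div_cpow {w : ℂ} (hw : 1 < ‖w‖) (e : ℂ) :
    logDeriv (fun z => (1 - z / w) ^ e) 1 = e * (1 - w)⁻¹ := by
  have hm := one_sub_div_mem_slitPlane hw
  have h0 := slitPlane_ne_zero hm
  have hd : HasDerivAt (fun z : ℂ => 1 - z / w) (-(1 / w)) 1 :=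
    ((hasDerivAt_id (1 : ℂ)).div_const w).const_sub 1
  have hw0 : w ≠ 0 := norm_pos_iff.1 (by linarith)
  have hw1 : w - 1 ≠ 0 := by
    intro h
    simp [sub_eq_zero.1 h] at hw
  have hw2 : 1 - w ≠ 0 := by rwa [← neg_ne_zero, neg_sub]
  rw [logDeriv_apply, (hd.cpow_const hm).deriv, cpow_sub _ _ h0, cpow_one]
  have he : (1 - 1 / w) ^ e ≠ 0 := fun h => h0 (cpow_eq_zero_iff _ _ |>.1 h).1
  have hk : 1 - 1 / w = (w - 1) / w := by field_simp
  generalize (1 - 1 / w) ^ e = t at he ⊢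
  rw [hk]
  field_simp
  ring

/-- with `q`, `b` as in Corollary 1, `b_{j0} = 1` and `|b_j| > 1` for
`j ≠ j0`, the function `G` above is analytic at `z = 1` with `G(1) ≠ 0`, and
`−G'(1)/G(1) = ((q'(1) − q(1))·q''(1) − 2·q(1)·q'(1)) / (2·q'(1)²)`, which is the
coefficient `A₁` in the expansion `Φ(z)(1 − z)^{1+β} = G(1)(1 + A₁(1 − z) + O((1−z)²))`
of `Φ(z) = (1 − z)^{−1−β} G(z)` at `z = 1`. -/
theorem Gfac_log_deriv_at_one (N : ℕ) (hN : 1 ≤ N) (q : Polynomial ℝ)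
    (hdeg : q.natDegree = N) (hcoeff : ∀ i, 0 ≤ q.coeff i) (hq0 : q.coeff 0 = 0)
    (b : Fin N → ℂ) (hb : Function.Injective b)
    (hroot : ∀ j, Polynomial.aeval (b j) q = ((q.eval 1 : ℝ) : ℂ))
    (j0 : Fin N) (hb1 : b j0 = 1) (hbig : ∀ j, j ≠ j0 → 1 < ‖b j‖) :
    AnalyticAt ℂ (Gfac N q b j0) 1 ∧ Gfac N q b j0 1 ≠ 0 ∧
    -(deriv (Gfac N q b j0) 1) / Gfac N q b j0 1 =
      (((q.derivative.eval 1 - q.eval 1) * q.derivative.derivative.eval 1 -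
          2 * q.eval 1 * q.derivative.eval 1) / (2 * q.derivative.eval 1 ^ 2) : ℝ) := by
  have hbn : ∀ j, b j ≠ 0 := by
    intro j
    by_cases hj : j = j0
    · rw [hj, hb1]
      exact one_ne_zero
    · exact norm_pos_iff.1 (one_pos.trans (hbig j hj))
  have han : ∀ j ∈ Finset.univ.erase j0, ∀ e : ℂ,
      AnalyticAt ℂ (fun z => (1 - z / b j) ^ e) 1 := fun j hj e =>
    (analyticAt_const.sub (analyticAt_id.div analyticAt_const (hbn j))).cpow analyticAt_const
      (Complex.one_sub_div_mem_slitPlane (hbig j (Finset.mem_erase.1 hj).1))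
  have hne : ∀ j ∈ Finset.univ.erase j0, ∀ e : ℂ, (1 - 1 / b j) ^ e ≠ 0 := fun j hj e h =>
    Complex.slitPlane_ne_zero
      (Complex.one_sub_div_mem_slitPlane (hbig j (Finset.mem_erase.1 hj).1))
      ((Complex.cpow_eq_zero_iff _ _).1 h).1
  have hprod := Finset.analyticAt_fun_prod (𝕜 := ℂ) (Finset.univ.erase j0) fun j hj => han j hj
    (-1 - ((q.eval 1 : ℝ) : ℂ) / (Polynomial.aeval (b j) q.derivative * b j))
  have hprod0 := Finset.prod_ne_zero_iff.2 fun j hj => hne j hj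
    (-1 - ((q.eval 1 : ℝ) : ℂ) / (Polynomial.aeval (b j) q.derivative * b j))
  refine ⟨analyticAt_id.mul hprod, mul_ne_zero one_ne_zero hprod0, ?_⟩
  have hlog : deriv (Gfac N q b j0) 1 / Gfac N q b j0 1 =
      1 + ∑ j ∈ Finset.univ.erase j0,
        (-1 - ((q.eval 1 : ℝ) : ℂ) / (Polynomial.aeval (b j) q.derivative * b j)) *
          (1 - b j)⁻¹ := by
    rw [← logDeriv_apply]
    unfold Gfac
    rw [logDeriv_mul (f := fun z => z) (1 : ℂ) one_ne_zero hprod0 differentiableAt_id hprod.differentiableAt,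
      logDeriv_prod (f := fun j (z : ℂ) => (1 - z / b j) ^
          (-1 - ((q.eval 1 : ℝ) : ℂ) / (Polynomial.aeval (b j) q.derivative * b j)))
        (fun j hj => hne j hj _) (fun j hj => (han j hj _).differentiableAt)]
    congr 1
    · simp
    · exact Finset.sum_congr rfl fun j hj =>
        Complex.logDeriv_one_sub_div_cpow (hbig j (Finset.mem_erase.1 hj).1) _
  rw [neg_div, hlog]
  have hmap := (q.map (algebraMap ℝ ℂ)).eq_C_mul_nodal_add_C (s := Finset.univ) hb.injOn
    ((q.eval 1 : ℝ) : ℂ) (by rw [natDegree_map]; omega) (by simp [hdeg])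
    fun j _ => by rw [eval_map_algebraMap, hroot]
  set c := (q.map (algebraMap ℝ ℂ)).leadingCoeff
  have hc0 : c ≠ 0 := leadingCoeff_ne_zero.2
    (ne_zero_of_natDegree_gt (n := 0) (by rw [natDegree_map]; omega))
  set P := Lagrange.nodal Finset.univ b with hP
  have hd1 : ∀ z : ℂ, aeval z q.derivative = c * P.derivative.eval z := fun z => by
    rw [← eval_map_algebraMap, ← derivative_map, hmap]
    simp
  have hd2 : ∀ z : ℂ, aeval z q.derivative.derivative = c * P.derivative.derivative.eval z :=
    fun z => by
      rw [← eval_map_algebraMap, ← derivative_map, ← derivative_map, hmap]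
      simp
  have hcast : ∀ p : ℝ[X], ((p.eval 1 : ℝ) : ℂ) = aeval (b j0) p := fun p => by
    rw [hb1]
    simpa using (aeval_algebraMap_apply ℂ (1 : ℝ) p).symm
  have hQ : ((q.eval 1 : ℝ) : ℂ) = -c * P.eval 0 := by
    have h := congrArg (eval 0) hmap
    rw [eval_add, eval_mul, eval_C, eval_C, ← coeff_zero_eq_eval_zero, coeff_map, hq0,
      map_zero] at h
    linear_combination -h
  have h1 := Lagrange.eval_derivative_derivative_nodal hb.injOn (Finset.mem_univ j0)
  have h2 := Lagrange.eval_derivative_nodal_mul_sum hb.injOn (Finset.mem_univ j0)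
  have h3 := Lagrange.eval_nodal_mul_sum (s := Finset.univ) hb.injOn ⟨j0, Finset.mem_univ j0⟩
    fun j _ => (hbn j).symm
  rw [← Finset.add_sum_erase _ _ (Finset.mem_univ j0)] at h3
  have hP1 : ∀ j, P.derivative.eval (b j) ≠ 0 := fun j =>
    Lagrange.eval_derivative_nodal_ne_zero hb.injOn (Finset.mem_univ j)
  rw [← hP] at h1 h2 h3
  push_cast
  rw [hcast q.derivative, hcast q.derivative.derivative, hd1, hd2]
  have hsum : ∑ j ∈ Finset.univ.erase j0,
        (-1 - ((q.eval 1 : ℝ) : ℂ) / (Polynomial.aeval (b j) q.derivative * b j)) *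
          (1 - b j)⁻¹ =
      -∑ j ∈ Finset.univ.erase j0, (b j0 - b j)⁻¹ + P.eval 0 *
        (∑ j ∈ Finset.univ.erase j0, (P.derivative.eval (b j))⁻¹ * (b j0 - b j)⁻¹ -
          ∑ j ∈ Finset.univ.erase j0, (P.derivative.eval (b j))⁻¹ * (0 - b j)⁻¹) := by
    rw [← Finset.sum_sub_distrib, Finset.mul_sum, ← Finset.sum_neg_distrib,
      ← Finset.sum_add_distrib]
    refine Finset.sum_congr rfl fun j hj => ?_
    have hj1 : 1 - b j ≠ 0 := by
      rw [← hb1]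
      exact sub_ne_zero.2 fun h => (Finset.mem_erase.1 hj).1 (hb h.symm)
    have := hP1 j
    have := hbn j
    rw [hd1, hQ, hb1]
    field_simp
    ring
  rw [hsum, h1, hQ]
  generalize ∑ j ∈ Finset.univ.erase j0, (b j0 - b j)⁻¹ = S at *
  generalize ∑ j ∈ Finset.univ.erase j0, (P.derivative.eval (b j))⁻¹ * (b j0 - b j)⁻¹ = T at *
  generalize ∑ j ∈ Finset.univ.erase j0, (P.derivative.eval (b j))⁻¹ * (0 - b j)⁻¹ = U at *
  have hp := hP1 j0
  rw [hb1] at h2 h3 hp ⊢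
  generalize P.derivative.eval 1 = p at *
  have hS : S = -(p * T) := by linear_combination h2
  have hU : P.eval 0 * U = 1 + P.eval 0 * p⁻¹ := by linear_combination h3
  subst hS
  rw [mul_sub, hU]
  field_simp
  ring
end

section
/- The function Φ(z) := z/(1 − z)^2 is analytic on the open unit disc, satisfies Φ(0) = 0 and Φ'(0) = 1, its n-th Taylor coefficient at 0 equals n for every n ≥ 1, and for every z with 0 < |z| < 1 it satisfies ∫_0^∞ Φ(z·e^{r(z − 1)}) dr = Φ(z). -/
open MeasureTheory

lemma koebe_analyticOnNhd :
    AnalyticOnNhd ℂ (fun z : ℂ => z / (1 - z) ^ 2) (Metric.ball 0 1) := by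
  intro z hz
  have h1 : 1 - z ≠ 0 := by
    intro h
    rw [← sub_eq_zero.mp h] at hz
    simp at hz
  exact analyticAt_id.div ((analyticAt_const.sub analyticAt_id).pow 2) (pow_ne_zero 2 h1)

lemma iteratedDeriv_koebe_div_factorial (n : ℕ) :
    iteratedDeriv n (fun z : ℂ => z / (1 - z) ^ 2) 0 / (n.factorial : ℂ) = (n : ℂ) := by
  have h1 : HasFPowerSeriesAt (fun z : ℂ => z / (1 - z) ^ 2)
      (FormalMultilinearSeries.ofScalars ℂ (fun n : ℕ => (n : ℂ))) 0 := by
    rw [hasFPowerSeriesAt_iff]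
    filter_upwards [Metric.ball_mem_nhds (0 : ℂ) one_pos] with z hz
    have h := hasSum_coe_mul_geometric_of_norm_lt_one (mem_ball_zero_iff.mp hz)
    simpa [FormalMultilinearSeries.coeff_ofScalars, mul_comm] using h
  have h2 := (koebe_analyticOnNhd 0 (by simp)).hasFPowerSeriesAt
  have h3 := congrArg (fun p => FormalMultilinearSeries.coeff p n)
    (h2.eq_formalMultilinearSeries h1)
  simpa [FormalMultilinearSeries.coeff_ofScalars] using h3

lemma integral_koebe_exp {z : ℂ} (hz : ‖z‖ < 1) :
    ∫ r : ℝ in Set.Ioi (0 : ℝ),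
        (z * Complex.exp ((r : ℂ) * (z - 1))) /
          (1 - z * Complex.exp ((r : ℂ) * (z - 1))) ^ 2 =
      z / (1 - z) ^ 2 := by
  set u : ℝ → ℂ := fun r => z * Complex.exp ((r : ℂ) * (z - 1)) with hu
  have hre : 0 < 1 - z.re := by linarith [Complex.re_le_norm z]
  have hz1 : z - 1 ≠ 0 := by
    intro h
    rw [sub_eq_zero.mp h] at hz
    simp at hz
  have hz1' : 1 - z ≠ 0 := by
    rw [← neg_sub]
    exact neg_ne_zero.mpr hz1
  have hnorm (r : ℝ) : ‖u r‖ = ‖z‖ * Real.exp (-(1 - z.re) * r) := by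
    simp only [hu, norm_mul, Complex.norm_exp]
    congr 2
    simp
    ring
  have hle {r : ℝ} (hr : 0 ≤ r) : ‖u r‖ ≤ ‖z‖ := by
    rw [hnorm]
    refine mul_le_of_le_one_right (norm_nonneg z) (Real.exp_le_one_iff.mpr ?_)
    nlinarith
  have hsub {r : ℝ} (hr : 0 ≤ r) : 1 - ‖z‖ ≤ ‖1 - u r‖ := by
    have h := norm_sub_norm_le (1 : ℂ) (u r)
    rw [norm_one] at h
    linarith [hle hr]
  have hne {r : ℝ} (hr : 0 ≤ r) : 1 - u r ≠ 0 :=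
    norm_pos_iff.mp (by linarith [hsub hr])
  have hud (r : ℝ) : HasDerivAt u (u r * (z - 1)) r := by
    have h := (((Complex.ofRealCLM.hasDerivAt (x := r)).mul_const (z - 1)).cexp).const_mul z
    simpa [hu, mul_assoc] using h
  have hderiv (r : ℝ) (hr : r ∈ Set.Ici (0 : ℝ)) :
      HasDerivAt (fun r => (1 - u r)⁻¹ / (z - 1)) (u r / (1 - u r) ^ 2) r := by
    have h := (((hud r).const_sub 1).fun_inv (hne hr)).div_const (z - 1)
    rwa [neg_neg, div_right_comm, mul_div_cancel_right₀ _ hz1] at h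
  have huc : Continuous u := by fun_prop
  have hint : IntegrableOn (fun r => u r / (1 - u r) ^ 2) (Set.Ioi 0) := by
    refine Integrable.mono'
      (((integrableOn_exp_mul_Ioi (neg_neg_of_pos hre) 0).const_mul ‖z‖).div_const
        ((1 - ‖z‖) ^ 2)) ?_ ?_
    · refine ContinuousOn.aestronglyMeasurable (fun r hr => ?_) measurableSet_Ioi
      have hr' : 0 ≤ r := le_of_lt hr
      exact (huc.continuousAt.div ((continuous_const.sub huc).pow 2).continuousAt
        (pow_ne_zero 2 (hne hr'))).continuousWithinAt
    · filter_upwards [ae_restrict_mem measurableSet_Ioi] with r hr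
      have hr' : 0 ≤ r := le_of_lt hr
      have hpos : 0 < 1 - ‖z‖ := by linarith
      rw [norm_div, norm_pow, ← hnorm]
      gcongr
      exact hsub hr'
  have hlim : Filter.Tendsto u Filter.atTop (nhds 0) := by
    rw [tendsto_zero_iff_norm_tendsto_zero]
    simp_rw [hnorm]
    have h := (Real.tendsto_exp_atBot.comp
      (Filter.tendsto_id.const_mul_atTop_of_neg (neg_neg_of_pos hre))).const_mul ‖z‖
    simpa using h
  have hlimF : Filter.Tendsto (fun r => (1 - u r)⁻¹ / (z - 1)) Filter.atTop
      (nhds ((1 - 0)⁻¹ / (z - 1))) :=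
    ((hlim.const_sub 1).inv₀ (by simp)).div_const _
  rw [integral_Ioi_of_hasDerivAt_of_tendsto' hderiv hint hlimF]
  have hu0 : u 0 = z := by simp [hu]
  rw [hu0, ← neg_sub 1 z]
  field_simp
  ring

/-- Example 0, simple Poisson case `q(z) = z`: the function
`Φ(z) = z/(1 − z)²` is analytic on the open unit disc, satisfies `Φ(0) = 0`,
`Φ'(0) = 1`, its `n`-th Taylor coefficient at `0` equals `n` for all `n ≥ 1`, and
`∫_0^∞ Φ(z·e^{r(z−1)}) dr = Φ(z)` for every `0 < |z| < 1`. -/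
theorem example_zero_simple_poisson :
    AnalyticOnNhd ℂ (fun z : ℂ => z / (1 - z) ^ 2) (Metric.ball 0 1) ∧
    (fun z : ℂ => z / (1 - z) ^ 2) 0 = 0 ∧
    deriv (fun z : ℂ => z / (1 - z) ^ 2) 0 = 1 ∧
    (∀ n : ℕ, 1 ≤ n →
      iteratedDeriv n (fun z : ℂ => z / (1 - z) ^ 2) 0 / (n.factorial : ℂ) = (n : ℂ)) ∧
    ∀ z : ℂ, z ≠ 0 → ‖z‖ < 1 →
      ∫ r : ℝ in Set.Ioi (0 : ℝ),
          (z * Complex.exp ((r : ℂ) * (z - 1))) /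
            (1 - z * Complex.exp ((r : ℂ) * (z - 1))) ^ 2 =
        z / (1 - z) ^ 2 := by
  refine ⟨koebe_analyticOnNhd, by simp, ?_, fun n _ => iteratedDeriv_koebe_div_factorial n,
    fun z _ hz => integral_koebe_exp hz⟩
  simpa using iteratedDeriv_koebe_div_factorial 1
end

section
/- Let m ≥ 1 be an integer and let Φ be analytic on the open unit disc with real nonnegative Taylor coefficients and Φ(0) = 0. Then Φ satisfies ∫_0^1 Φ(z·(r + (1 − r)z)^m) dr = Φ(z)/(m + 1) for all z ∈ (0, 1) if and only if Φ satisfies ∫_{z^{m+1}}^{z} Φ(w)·w^{1/m − 1} dw = (m/(m + 1))·(1 − z)·z^{1/m}·Φ(z) for all z ∈ (0, 1). -/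
/-- The weight `w ^ (1 / m - 1)` times the derivative of `r ↦ z * (r + (1 - r) * z) ^ m` is
constant: with `u = r + (1 - r) * z` and `w = z * u ^ m`. -/
lemma rpow_mul_deriv_binomial_kernel {m : ℕ} (hm : m ≠ 0) {z u : ℝ} (hz : 0 < z) (hu : 0 < u) :
    (z * u ^ m) ^ ((1 : ℝ) / m - 1) * (z * (m * u ^ (m - 1) * (1 - z))) =
      m * (1 - z) * z ^ ((1 : ℝ) / m) := by
  have hw : 0 < z * u ^ m := by positivity
  have hroot : (u ^ m) ^ ((1 : ℝ) / m) = u := by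
    rw [one_div, Real.pow_rpow_inv_natCast hu.le hm]
  rw [Real.rpow_sub_one hw.ne', Real.mul_rpow hz.le (by positivity), hroot,
    ← mul_pow_sub_one hm u]
  field_simp

/-- The substitution `w = z * (r + (1 - r) * z) ^ m` in the integral of a binomial kernel. -/
lemma integral_binomial_kernel_eq {m : ℕ} (hm : m ≠ 0) (f : ℝ → ℝ) {z : ℝ}
    (hz : z ∈ Set.Ioo (0 : ℝ) 1) :
    ∫ w in (z ^ (m + 1))..z, f w * w ^ ((1 : ℝ) / m - 1) =
      m * (1 - z) * z ^ ((1 : ℝ) / m) *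
        ∫ r in (0 : ℝ)..1, f (z * (r + (1 - r) * z) ^ m) := by
  obtain ⟨hz0, hz1⟩ := hz
  have hpos : ∀ r ∈ Set.Icc (0 : ℝ) 1, 0 < r + (1 - r) * z := fun r hr ↦ by
    nlinarith [hr.1, hr.2, mul_nonneg hr.1 (sub_nonneg.2 hz1.le)]
  have hderiv (r : ℝ) : HasDerivAt (fun r : ℝ ↦ z * (r + (1 - r) * z) ^ m)
      (z * (m * (r + (1 - r) * z) ^ (m - 1) * (1 - z))) r := by
    have h : HasDerivAt (fun r : ℝ ↦ r + (1 - r) * z) (1 - z) r := by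
      convert! (hasDerivAt_id r).add (((hasDerivAt_id r).const_sub 1).mul_const z) using 1
      ring
    exact (h.pow m).const_mul z
  have hsubst := intervalIntegral.integral_comp_mul_deriv_of_deriv_nonneg (a := 0) (b := 1)
    (g := fun w ↦ f w * w ^ ((1 : ℝ) / m - 1))
    (fun r _ ↦ (hderiv r).continuousAt.continuousWithinAt) (fun r _ ↦ hderiv r) fun r hr ↦ by
      rw [min_eq_left zero_le_one, max_eq_right zero_le_one] at hr
      have := hpos r (Set.Ioo_subset_Icc_self hr)
      have := sub_pos.2 hz1
      positivity
  have hleft : z * (0 + (1 - 0) * z) ^ m = z ^ (m + 1) := by ring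
  have hright : z * (1 + (1 - 1) * z) ^ m = z := by simp
  rw [hleft, hright] at hsubst
  rw [← hsubst, ← intervalIntegral.integral_const_mul]
  refine intervalIntegral.integral_congr fun r hr ↦ ?_
  rw [Set.uIcc_of_le zero_le_one] at hr
  simp only [Function.comp_apply]
  rw [mul_assoc, rpow_mul_deriv_binomial_kernel hm hz0 (hpos r hr), mul_comm]


/-- Example 5, change of variables: let `m ≥ 1` and let `Φ` be (the real
restriction of) an analytic function on the open unit disc with nonnegative Taylor
coefficients `φ_n` and `Φ(0) = 0` (i.e. `φ_0 = 0`).  Then `Φ` satisfies the Schröder-type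
equation `∫_0^1 Φ(z(r + (1−r)z)^m) dr = Φ(z)/(m+1)` for all `z ∈ (0,1)` if and only if it
satisfies `∫_{z^{m+1}}^z Φ(w)·w^{1/m − 1} dw = (m/(m+1))·(1−z)·z^{1/m}·Φ(z)` for all
`z ∈ (0,1)`. -/
theorem binomial_kernel_change_of_variables (m : ℕ) (hm : 1 ≤ m)
    (φ : ℕ → ℝ) (hφnn : ∀ n, 0 ≤ φ n) (hφ0 : φ 0 = 0) (Φ : ℝ → ℝ)
    (hsum : ∀ z : ℝ, |z| < 1 → HasSum (fun n : ℕ => φ n * z ^ n) (Φ z)) :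
    (∀ z ∈ Set.Ioo (0 : ℝ) 1,
        ∫ r in (0 : ℝ)..1, Φ (z * (r + (1 - r) * z) ^ m) = Φ z / ((m : ℝ) + 1)) ↔
    (∀ z ∈ Set.Ioo (0 : ℝ) 1,
        ∫ w in (z ^ (m + 1))..z, Φ w * w ^ ((1 : ℝ) / m - 1) =
          ((m : ℝ) / ((m : ℝ) + 1)) * (1 - z) * z ^ ((1 : ℝ) / m) * Φ z) := by
  refine forall₂_congr fun z hz ↦ ?_
  have hm0 : m ≠ 0 := by omega
  have hm' : (0 : ℝ) < m := by positivity
  have hc : (m : ℝ) * (1 - z) * z ^ ((1 : ℝ) / m) ≠ 0 :=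
    (mul_pos (mul_pos hm' (sub_pos.2 hz.2)) (Real.rpow_pos_of_pos hz.1 _)).ne'
  have hr : (m : ℝ) / (m + 1) * (1 - z) * z ^ ((1 : ℝ) / m) * Φ z =
      m * (1 - z) * z ^ ((1 : ℝ) / m) * (Φ z / (m + 1)) := by ring
  rw [integral_binomial_kernel_eq hm0 Φ hz, hr, mul_right_inj' hc]
end

section
/- Let m ≥ 1 be an integer and let Φ(z) = Σ_{n=1}^∞ φ_n z^n be analytic on the open unit disc with φ_1 = 1, satisfying ∫_{z^{m+1}}^{z} Φ(w)·w^{1/m − 1} dw = (m/(m + 1))·(1 − z)·z^{1/m}·Φ(z) for all z ∈ (0, 1). Then for every n > 1: φ_n = ((mn + 1)/(m(n − 1)))·φ_{n−1} if (m + 1) does not divide n − 1, and φ_n = ((mn + 1)/(m(n − 1)))·φ_{n−1} − ((m + 1)^2/(m(n − 1)))·φ_{(n−1)/(m+1)} if (m + 1) divides n − 1. -/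
/-- A real power series that sums to zero at every point of `(0, 1)` has zero coefficients. -/
theorem coeff_eq_zero_of_hasSum_zero_on_Ioo (c : ℕ → ℝ)
    (h : ∀ z ∈ Set.Ioo (0 : ℝ) 1, HasSum (fun n : ℕ => c n * z ^ n) 0) (n : ℕ) : c n = 0 := by
  let p := FormalMultilinearSeries.ofScalars ℝ c
  have hr : (((1 / 2 : NNReal) : NNReal) : ENNReal) ≤ p.radius := by
    apply p.le_radius_of_summable_norm
    have := (h (1 / 2) ⟨by norm_num, by norm_num⟩).summable.norm
    refine this.congr fun k => ?_
    simp [p]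
  have hpos : 0 < p.radius := lt_of_lt_of_le (by norm_num) hr
  have hp : HasFPowerSeriesAt p.sum p 0 := (p.hasFPowerSeriesOnBall hpos).hasFPowerSeriesAt
  have hzero : ∀ z ∈ Set.Ioo (0 : ℝ) 1, p.sum z = 0 := by
    intro z hz
    rw [← (h z hz).tsum_eq]
    simp [FormalMultilinearSeries.sum, p, mul_comm]
  have hfreq : ∃ᶠ z in nhdsWithin (0 : ℝ) {0}ᶜ, p.sum z = 0 := by
    have h1 : ∀ᶠ z in nhdsWithin (0 : ℝ) (Set.Ioi 0), p.sum z = 0 := by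
      filter_upwards [Ioo_mem_nhdsGT (zero_lt_one : (0 : ℝ) < 1)] with z hz using hzero z hz
    exact h1.frequently.filter_mono (nhdsWithin_mono _ fun x hx => ne_of_gt hx)
  have hev := hp.analyticAt.frequently_zero_iff_eventually_zero.1 hfreq
  have hp0 : p = 0 := (hp.congr hev).eq_zero
  have : p.coeff n = 0 := by rw [hp0]; simp [FormalMultilinearSeries.coeff]
  simpa [p, FormalMultilinearSeries.coeff_ofScalars] using this

/-- Termwise integration of a power series against `w ^ (a - 1)` inside `(0, 1)`. -/
theorem hasSum_integral_powerSeries_mul_rpow (φ : ℕ → ℝ) (Φ : ℝ → ℝ)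
    (hsum : ∀ z : ℝ, |z| < 1 → HasSum (fun n : ℕ => φ n * z ^ n) (Φ z))
    {a x y : ℝ} (ha : 0 < a) (hx : 0 < x) (hxy : x ≤ y) (hy : y < 1) :
    HasSum (fun n : ℕ => φ n / (n + a) * (y ^ (n + a) - x ^ (n + a)))
      (∫ w in x..y, Φ w * w ^ (a - 1)) := by
  have hy0 : 0 < y := hx.trans_le hxy
  have hmem : ∀ w ∈ Set.uIoc x y, 0 < w ∧ w ≤ y := by
    intro w hw
    rw [Set.uIoc_of_le hxy] at hw
    exact ⟨hx.trans hw.1, hw.2⟩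
  have h0 : (0 : ℝ) ∉ Set.uIcc x y := by
    rw [Set.uIcc_of_le hxy]
    exact fun h => absurd h.1 (not_le.2 hx)
  have hint : IntervalIntegrable (fun w : ℝ => w ^ (a - 1)) MeasureTheory.volume x y :=
    intervalIntegral.intervalIntegrable_rpow (Or.inr h0)
  have hs : Summable fun n : ℕ => |φ n| * y ^ n := by
    refine (hsum y (by rwa [abs_of_pos hy0])).summable.abs.congr fun n => ?_
    rw [abs_mul, abs_of_nonneg (pow_nonneg hy0.le n)]
  have key := intervalIntegral.hasSum_integral_of_dominated_convergence
    (μ := MeasureTheory.volume) (a := x) (b := y)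
    (F := fun (n : ℕ) (w : ℝ) => φ n * w ^ n * w ^ (a - 1))
    (f := fun w => Φ w * w ^ (a - 1))
    (fun n w => |φ n| * y ^ n * w ^ (a - 1)) ?_ ?_ ?_ ?_ ?_
  · refine key.congr_fun fun n => ?_
    have hcongr : ∫ t in x..y, φ n * t ^ n * t ^ (a - 1) =
        ∫ t in x..y, φ n * t ^ ((n : ℝ) + a - 1) := by
      refine intervalIntegral.integral_congr fun t ht => ?_
      rw [Set.uIcc_of_le hxy] at ht
      have ht0 : 0 < t := hx.trans_le ht.1
      rw [mul_assoc, ← Real.rpow_natCast t n, ← Real.rpow_add ht0, add_sub_assoc]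
    have hna : (0 : ℝ) < n + a := by positivity
    rw [hcongr, intervalIntegral.integral_const_mul, integral_rpow (Or.inl (by linarith)),
      sub_add_cancel]
    ring
  · intro n
    exact ((by fun_prop : Measurable fun w : ℝ => φ n * w ^ n * w ^ (a - 1))).aestronglyMeasurable
  · refine fun n => Filter.Eventually.of_forall fun t ht => ?_
    obtain ⟨ht0, hty⟩ := hmem t ht
    rw [Real.norm_eq_abs, abs_mul, abs_mul, abs_of_nonneg (Real.rpow_nonneg ht0.le _),
      abs_of_nonneg (pow_nonneg ht0.le n)]
    gcongr
  · exact Filter.Eventually.of_forall fun t _ => hs.mul_right _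
  · simp_rw [tsum_mul_right]
    exact hint.const_mul _
  · refine Filter.Eventually.of_forall fun t ht => ?_
    obtain ⟨ht0, hty⟩ := hmem t ht
    exact (hsum t (by rw [abs_of_pos ht0]; linarith)).mul_right _

/-- Dividing the coefficients of a power series by `n + a` preserves summability. -/
theorem summable_div_add_mul_pow {φ : ℕ → ℝ} {a w : ℝ} (ha : 0 < a)
    (h : Summable fun n : ℕ => φ n * w ^ n) :
    Summable fun n : ℕ => φ n / (n + a) * w ^ n := by
  refine Summable.of_norm_bounded (h.abs.mul_left a⁻¹) fun n => ?_
  have hna : a ≤ n + a := le_add_of_nonneg_left n.cast_nonneg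
  rw [Real.norm_eq_abs, div_mul_eq_mul_div, abs_div, abs_of_pos (ha.trans_le hna),
    div_eq_inv_mul]
  gcongr

/-- Example 5, coefficient recurrence: let `m ≥ 1` and let
`Φ(z) = Σ_{n≥1} φ_n z^n` be (the real restriction of) an analytic function on the open
unit disc with `φ_1 = 1`, satisfying
`∫_{z^{m+1}}^z Φ(w)·w^{1/m − 1} dw = (m/(m+1))·(1−z)·z^{1/m}·Φ(z)` for all `z ∈ (0,1)`.
Then for `n > 1`: `φ_n = ((mn+1)/(m(n−1)))·φ_{n−1}` when `(m+1) ∤ (n−1)`, and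
`φ_n = ((mn+1)/(m(n−1)))·φ_{n−1} − ((m+1)²/(m(n−1)))·φ_{(n−1)/(m+1)}` when
`(m+1) ∣ (n−1)`. -/
theorem binomial_kernel_recurrence (m : ℕ) (hm : 1 ≤ m)
    (φ : ℕ → ℝ) (hφ0 : φ 0 = 0) (hφ1 : φ 1 = 1) (Φ : ℝ → ℝ)
    (hsum : ∀ z : ℝ, |z| < 1 → HasSum (fun n : ℕ => φ n * z ^ n) (Φ z))
    (heq : ∀ z ∈ Set.Ioo (0 : ℝ) 1,
      ∫ w in (z ^ (m + 1))..z, Φ w * w ^ ((1 : ℝ) / m - 1) =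
        ((m : ℝ) / ((m : ℝ) + 1)) * (1 - z) * z ^ ((1 : ℝ) / m) * Φ z) :
    ∀ n : ℕ, 1 < n →
      (¬ (m + 1) ∣ (n - 1) →
        φ n = (((m : ℝ) * n + 1) / ((m : ℝ) * ((n : ℝ) - 1))) * φ (n - 1)) ∧
      ((m + 1) ∣ (n - 1) →
        φ n = (((m : ℝ) * n + 1) / ((m : ℝ) * ((n : ℝ) - 1))) * φ (n - 1) -
          (((m : ℝ) + 1) ^ 2 / ((m : ℝ) * ((n : ℝ) - 1))) * φ ((n - 1) / (m + 1))) := by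
  have hm0 : (0 : ℝ) < m := by exact_mod_cast hm
  set a : ℝ := (1 : ℝ) / m with ha_def
  have ha : 0 < a := by positivity
  have hma : (m : ℝ) * a = 1 := by rw [ha_def]; field_simp
  have hcoeff := coeff_eq_zero_of_hasSum_zero_on_Ioo (fun n : ℕ => φ n / (n + a)
    - (if (m + 1) ∣ n - 1 then φ ((n - 1) / (m + 1)) / (((n - 1) / (m + 1) : ℕ) + a) else 0)
    - (m : ℝ) / ((m : ℝ) + 1) * (φ n - φ (n - 1))) ?_
  · intro n hn
    have hc := hcoeff n
    obtain ⟨k, rfl⟩ : ∃ k, n = k + 1 := ⟨n - 1, by omega⟩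
    have hk : (0 : ℝ) < k := by
      have : 0 < k := by omega
      exact_mod_cast this
    have hainv : a = 1 / (m : ℝ) := ha_def
    simp only [Nat.add_sub_cancel] at hc ⊢
    push_cast at hc ⊢
    constructor
    · intro hd
      rw [if_neg hd, hainv, sub_zero] at hc
      rw [add_sub_cancel_right]
      field_simp at hc ⊢
      apply mul_left_cancel₀ hm0.ne'
      linear_combination -hc
    · rintro ⟨j, rfl⟩
      have hj : (m + 1) * j / (m + 1) = j := Nat.mul_div_cancel_left j (by omega)
      rw [if_pos (dvd_mul_right _ _), hj, hainv] at hc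
      push_cast at hc hk ⊢
      have hj0 : (j : ℝ) ≠ 0 := by
        rintro h
        simp [h] at hk
      rw [hj, add_sub_cancel_right]
      field_simp at hc ⊢
      have hne : (m : ℝ) * (m * j + 1) ≠ 0 := by positivity
      apply mul_left_cancel₀ hne
      linear_combination -hc
  · intro z hz
    obtain ⟨hz0, hz1⟩ := hz
    have habs : |z| < 1 := by rwa [abs_of_pos hz0]
    have hw0 : 0 < z ^ (m + 1) := by positivity
    have hw1 : z ^ (m + 1) < 1 := pow_lt_one₀ hz0.le hz1 (by omega)
    have hwz : z ^ (m + 1) ≤ z := pow_le_of_le_one hz0.le hz1.le (by omega)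
    have hΦ := hsum z habs
    have hH := (summable_div_add_mul_pow ha hΦ.summable).hasSum
    have hHw := (summable_div_add_mul_pow ha
      (hsum (z ^ (m + 1)) (by rwa [abs_of_pos hw0])).summable).hasSum
    set H := ∑' n : ℕ, φ n / (n + a) * z ^ n
    set Hw := ∑' n : ℕ, φ n / (n + a) * (z ^ (m + 1)) ^ n
    have hI := hasSum_integral_powerSeries_mul_rpow φ Φ hsum ha hw0 hwz hz1
    rw [heq z ⟨hz0, hz1⟩] at hI
    have hI' := ((hH.sub (hHw.mul_right z)).mul_right (z ^ a)).unique (hI.congr_fun fun n => by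
      have h1 : (z ^ (m + 1)) ^ ((n : ℝ) + a) = (z ^ (m + 1)) ^ n * (z * z ^ a) := by
        rw [Real.rpow_add hw0, Real.rpow_natCast, ← Real.rpow_natCast z (m + 1),
          ← Real.rpow_mul hz0.le]
        congr 1
        nth_rewrite 2 [← Real.rpow_one z]
        rw [← Real.rpow_add hz0]
        congr 1
        push_cast
        linear_combination hma
      rw [h1, Real.rpow_add hz0, Real.rpow_natCast]
      ring)
    have hza : z ^ a ≠ 0 := (Real.rpow_pos_of_pos hz0 a).ne'
    have hval : H - Hw * z - (m : ℝ) / ((m : ℝ) + 1) * (Φ z - Φ z * z) = 0 := by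
      apply mul_right_cancel₀ hza
      linear_combination hI'
    have hshift : HasSum (fun n : ℕ => φ (n - 1) * z ^ n) (Φ z * z) := by
      rw [← Function.Injective.hasSum_iff (Nat.succ_injective)]
      · exact (hΦ.mul_right z).congr_fun fun n => by simp [pow_succ, mul_assoc]
      · intro n hn
        have : n = 0 := by
          by_contra h
          exact hn ⟨n - 1, by simp; omega⟩
        simp [this, hφ0]
    have hdil : HasSum (fun n : ℕ => (if (m + 1) ∣ n - 1 then
        φ ((n - 1) / (m + 1)) / (((n - 1) / (m + 1) : ℕ) + a) else 0) * z ^ n) (Hw * z) := by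
      have hinj : Function.Injective fun n : ℕ => (m + 1) * n + 1 := fun i j hij =>
        Nat.eq_of_mul_eq_mul_left (Nat.succ_pos m) (Nat.succ_injective hij)
      rw [← hinj.hasSum_iff]
      · refine (hHw.mul_right z).congr_fun fun n => ?_
        have hj : (m + 1) * n / (m + 1) = n := Nat.mul_div_cancel_left n (by omega)
        simp only [Function.comp, Nat.add_sub_cancel, dvd_mul_right, if_true, hj]
        rw [pow_succ, pow_mul, mul_assoc]
      · intro n hn
        split_ifs with hd
        · obtain ⟨j, hj⟩ := hd
          have : n = 0 := by
            by_contra h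
            exact hn ⟨j, by simp only; omega⟩
          simp [this, hφ0]
        · simp
    have htotal := (hH.sub hdil).sub ((hΦ.sub hshift).mul_left ((m : ℝ) / ((m : ℝ) + 1)))
    rw [hval] at htotal
    exact htotal.congr_fun fun n => by ring
end

section
/- Let m ≥ 1 be an integer and let Φ(z) = Σ_{n=1}^∞ φ_n z^n be analytic on the open unit disc, satisfying ∫_{z^{m+1}}^{z} Φ(w)·w^{1/m − 1} dw = (m/(m + 1))·(1 − z)·z^{1/m}·Φ(z) for all z ∈ (0, 1). Then for every n ≥ 1: (m/(m + 1))·φ_{(m+1)n} = Σ_{j=n}^{(m+1)n} φ_j / (j + 1/m). -/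
/-- Transport of `HasSum` along a pointwise equality of terms and an equality of sums. -/
theorem hasSum_of_eq {f g : ℕ → ℝ} {a b : ℝ} (h : HasSum f a) (hfg : ∀ n, g n = f n)
    (hab : b = a) : HasSum g b := by
  rw [funext hfg, hab]
  exact h

open Filter Topology MeasureTheory in
/-- A real power series vanishing on `(0, 1)` has zero coefficients. -/
theorem coeff_eq_zero_of_hasSum_zero {d : ℕ → ℝ}
    (hd : ∀ z ∈ Set.Ioo (0 : ℝ) 1, HasSum (fun n : ℕ => d n * z ^ n) 0) (n : ℕ) : d n = 0 := by
  have hsummable : ∀ z : ℝ, |z| < 1 → Summable (fun n : ℕ => d n * z ^ n) := by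
    intro z hz
    rcases eq_or_ne z 0 with rfl | h0
    · refine summable_of_ne_finset_zero (s := {0}) fun k hk => ?_
      simp [zero_pow (by simpa using hk : k ≠ 0)]
    · refine Summable.of_norm ?_
      simpa [abs_mul, abs_pow] using (hd |z| ⟨abs_pos.mpr h0, hz⟩).summable.norm
  set F : ℝ → ℝ := fun z => ∑' n : ℕ, d n * z ^ n with hF
  have hps : HasFPowerSeriesAt F (FormalMultilinearSeries.ofScalars ℝ d) 0 := by
    rw [hasFPowerSeriesAt_iff]
    filter_upwards [Metric.ball_mem_nhds (0 : ℝ) one_pos] with z hz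
    have hz' : |z| < 1 := by simpa using hz
    simpa [FormalMultilinearSeries.coeff_ofScalars, mul_comm] using (hsummable z hz').hasSum
  have hfreq : ∃ᶠ z in 𝓝[≠] (0 : ℝ), F z = 0 := by
    have h1 : ∃ᶠ z in 𝓝[>] (0 : ℝ), F z = 0 := by
      refine Eventually.frequently ?_
      filter_upwards [Ioo_mem_nhdsGT (one_pos : (0 : ℝ) < 1)] with z hz
      exact (hd z hz).tsum_eq
    exact h1.filter_mono (nhdsWithin_mono _ fun z hz => ne_of_gt hz)
  have hev := hps.analyticAt.frequently_zero_iff_eventually_zero.mp hfreq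
  have h0 := hps.eq_zero_of_eventually hev
  rw [← FormalMultilinearSeries.coeff_ofScalars (𝕜 := ℝ) (p := d) (n := n), h0]
  rfl

/-- Termwise integration of a power series against the kernel `w ^ (s - 1)`. -/
theorem hasSum_integral_mul_rpow {φ : ℕ → ℝ} {Φ : ℝ → ℝ}
    (hsum : ∀ z : ℝ, |z| < 1 → HasSum (fun n : ℕ => φ n * z ^ n) (Φ z))
    {s x y : ℝ} (hs : 0 < s) (hx : 0 < x) (hxy : x ≤ y) (hy : y < 1) :
    HasSum (fun n : ℕ => φ n / (n + s) * (y ^ ((n : ℝ) + s) - x ^ ((n : ℝ) + s)))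
      (∫ w in x..y, Φ w * w ^ (s - 1)) := by
  have hy0 : 0 < y := hx.trans_le hxy
  have hpos : ∀ t ∈ Set.uIoc x y, 0 < t ∧ t ≤ y := fun t ht => by
    rw [Set.uIoc_of_le hxy] at ht
    exact ⟨hx.trans ht.1, ht.2⟩
  have hsy : Summable fun n : ℕ => |φ n| * y ^ n := by
    simpa [abs_mul, abs_pow, abs_of_pos hy0] using
      (hsum y (by rwa [abs_of_pos hy0])).summable.norm
  have key := intervalIntegral.hasSum_integral_of_dominated_convergence (μ := MeasureTheory.volume)
    (a := x) (b := y) (F := fun (n : ℕ) (t : ℝ) => φ n * t ^ n * t ^ (s - 1))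
    (f := fun t => Φ t * t ^ (s - 1))
    (fun n t => |φ n| * y ^ n * t ^ (s - 1))
    (fun n => (by fun_prop : Measurable fun t : ℝ => φ n * t ^ n * t ^ (s - 1)).aestronglyMeasurable)
    (fun n => .of_forall fun t ht => by
      obtain ⟨h0, h1⟩ := hpos t ht
      rw [norm_mul, norm_mul, norm_pow, Real.norm_of_nonneg h0.le, Real.norm_eq_abs,
        Real.norm_of_nonneg (Real.rpow_nonneg h0.le _)]
      gcongr)
    (.of_forall fun t _ => hsy.mul_right _)
    (by
      simp_rw [tsum_mul_right]
      refine ContinuousOn.intervalIntegrable ?_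
      refine continuousOn_const.mul (continuousOn_id.rpow_const fun t ht => Or.inl ?_)
      rw [Set.uIcc_of_le hxy] at ht
      exact (hx.trans_le ht.1).ne')
    (.of_forall fun t ht => by
      obtain ⟨h0, h1⟩ := hpos t ht
      exact (hsum t (by rw [abs_of_pos h0]; linarith)).mul_right _)
  refine hasSum_of_eq key (fun n => ?_) rfl
  have hn : 0 < (n : ℝ) + s := by positivity
  have hcongr : ∫ t in x..y, φ n * t ^ n * t ^ (s - 1) =
      ∫ t in x..y, φ n * t ^ ((n : ℝ) + s - 1) := by
    refine intervalIntegral.integral_congr fun t ht => ?_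
    rw [Set.uIcc_of_le hxy] at ht
    have h0 : 0 < t := hx.trans_le ht.1
    rw [add_sub_assoc, Real.rpow_add h0, Real.rpow_natCast, mul_assoc]
  rw [hcongr, intervalIntegral.integral_const_mul, integral_rpow (Or.inl (by linarith)),
    sub_add_cancel]
  ring

/-- Example 5, identity (320): let `m ≥ 1` and let
`Φ(z) = Σ_{n≥1} φ_n z^n` be (the real restriction of) an analytic function on the open
unit disc satisfying
`∫_{z^{m+1}}^z Φ(w)·w^{1/m − 1} dw = (m/(m+1))·(1−z)·z^{1/m}·Φ(z)` for all `z ∈ (0,1)`.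
Then for every `n ≥ 1`: `(m/(m+1))·φ_{(m+1)n} = Σ_{j=n}^{(m+1)n} φ_j/(j + 1/m)`. -/
theorem binomial_kernel_identity (m : ℕ) (hm : 1 ≤ m)
    (φ : ℕ → ℝ) (hφ0 : φ 0 = 0) (Φ : ℝ → ℝ)
    (hsum : ∀ z : ℝ, |z| < 1 → HasSum (fun n : ℕ => φ n * z ^ n) (Φ z))
    (heq : ∀ z ∈ Set.Ioo (0 : ℝ) 1,
      ∫ w in (z ^ (m + 1))..z, Φ w * w ^ ((1 : ℝ) / m - 1) =
        ((m : ℝ) / ((m : ℝ) + 1)) * (1 - z) * z ^ ((1 : ℝ) / m) * Φ z) :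
    ∀ n : ℕ, 1 ≤ n →
      ((m : ℝ) / ((m : ℝ) + 1)) * φ ((m + 1) * n) =
        ∑ j ∈ Finset.Icc n ((m + 1) * n), φ j / ((j : ℝ) + 1 / (m : ℝ)) := by
  intro n hn
  have hm0 : (0 : ℝ) < m := by exact_mod_cast hm
  set s : ℝ := 1 / (m : ℝ) with hs
  have hs0 : 0 < s := by positivity
  set c : ℝ := (m : ℝ) / ((m : ℝ) + 1) with hc
  set a : ℕ → ℝ := fun j => φ j / ((j : ℝ) + s) with ha
  set e : ℕ → ℕ := fun j => (m + 1) * j + 1 with he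
  have he_inj : Function.Injective e := fun i j hij => by
    simpa [he] using hij
  set b : ℕ → ℝ := Function.extend e a 0 with hb
  obtain ⟨ψ, hψ0, hψs⟩ : ∃ ψ : ℕ → ℝ, ψ 0 = 0 ∧ ∀ k, ψ (k + 1) = φ k :=
    ⟨fun k => k.casesOn 0 φ, rfl, fun _ => rfl⟩
  have hd : ∀ k, a k - b k - c * (φ k - ψ k) = 0 := by
    refine coeff_eq_zero_of_hasSum_zero fun z hz => ?_
    obtain ⟨hz0, hz1⟩ := hz
    have hΦ := hsum z (by rwa [abs_of_pos hz0])
    have hA : Summable fun k : ℕ => a k * z ^ k := by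
      refine Summable.of_norm_bounded (hΦ.summable.norm.mul_left s⁻¹) fun k => ?_
      have hk : s ≤ (k : ℝ) + s := by simp
      simp only [ha, norm_mul, norm_div, Real.norm_of_nonneg (hs0.le.trans hk)]
      rw [div_eq_inv_mul, mul_assoc]
      gcongr
    have hAe : Summable fun k : ℕ => a k * z ^ e k := by
      refine Summable.of_norm_bounded hA.norm fun k => ?_
      rw [norm_mul, norm_mul, norm_pow, norm_pow, Real.norm_of_nonneg hz0.le]
      gcongr ?_ * ?_
      exact pow_le_pow_of_le_one hz0.le hz1.le (by simp only [he]; nlinarith)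
    have hB : HasSum (fun k : ℕ => b k * z ^ k) (∑' k, a k * z ^ e k) := by
      rw [← he_inj.hasSum_iff]
      · convert hAe.hasSum using 2 with k
        simp [hb, he_inj.extend_apply]
      · intro k hk
        simp [hb, Function.extend_apply' a (0 : ℕ → ℝ) k hk]
    have hψsum : HasSum (fun k : ℕ => ψ k * z ^ k) (z * Φ z) := by
      rw [← hasSum_nat_add_iff' 1]
      refine hasSum_of_eq (hΦ.mul_left z) (fun k => ?_) ?_
      · rw [hψs]
        ring
      · simp [hψ0]
    have hI := hasSum_integral_mul_rpow hsum hs0 (pow_pos hz0 (m + 1))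
      (pow_le_of_le_one hz0.le hz1.le (by simp)) hz1
    rw [heq z ⟨hz0, hz1⟩] at hI
    have hdiff : (∑' k, a k * z ^ k) - ∑' k, a k * z ^ e k = c * (1 - z) * Φ z := by
      have hzs : 0 < z ^ s := Real.rpow_pos_of_pos hz0 s
      have h1 := (hA.hasSum.sub hAe.hasSum).mul_left (z ^ s)
      have h2 := h1.unique (by
        refine hasSum_of_eq hI (fun k => ?_) rfl
        have h3 : (z ^ (m + 1)) ^ ((k : ℝ) + s) = z ^ s * z ^ e k := by
          rw [← Real.rpow_natCast z (m + 1), ← Real.rpow_mul hz0.le,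
            ← Real.rpow_natCast z (e k), ← Real.rpow_add hz0]
          congr 1
          simp only [he, hs]
          push_cast
          field_simp
          ring
        rw [h3, Real.rpow_add hz0, Real.rpow_natCast]
        ring)
      refine mul_left_cancel₀ hzs.ne' (h2.trans ?_)
      ring
    refine hasSum_of_eq ((hA.hasSum.sub hB).sub ((hΦ.sub hψsum).mul_left c)) (fun k => ?_) ?_
    · ring
    · rw [hdiff]; ring
  have hpartial : ∀ N, c * φ N = ∑ k ∈ Finset.range (N + 1), (a k - b k) := by
    intro N
    induction N with
    | zero =>
      have := hd 0
      rw [hψ0] at this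
      simp only [zero_add, Finset.sum_range_one]
      linarith
    | succ N ih =>
      have := hd (N + 1)
      rw [hψs] at this
      rw [Finset.sum_range_succ, ← ih]
      linarith
  have hbsum : ∑ k ∈ Finset.range ((m + 1) * n + 1), b k = ∑ j ∈ Finset.range n, a j := by
    have himage : ∑ k ∈ (Finset.range n).image e, b k = ∑ j ∈ Finset.range n, a j := by
      rw [Finset.sum_image he_inj.injOn]
      exact Finset.sum_congr rfl fun j _ => he_inj.extend_apply _ _ _
    rw [← himage]
    symm
    refine Finset.sum_subset (fun k hk => ?_) fun k hk hk' => ?_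
    · obtain ⟨j, hj, rfl⟩ := Finset.mem_image.mp hk
      have hj' := Finset.mem_range.mp hj
      simp only [he, Finset.mem_range]
      nlinarith
    · refine Function.extend_apply' a (0 : ℕ → ℝ) k ?_
      rintro ⟨j, rfl⟩
      refine hk' (Finset.mem_image_of_mem e (Finset.mem_range.mpr ?_))
      have := Finset.mem_range.mp hk
      simp only [he, add_lt_add_iff_right] at this
      exact lt_of_mul_lt_mul_left this (Nat.zero_le _)
  rw [hpartial, Finset.sum_sub_distrib, hbsum,
    ← Finset.sum_range_add_sum_Ico a (by nlinarith : n ≤ (m + 1) * n + 1), add_sub_cancel_left]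
  rfl
end

section
/- Let m ≥ 1 be an integer. The complex number α = −1 satisfies (m + 1)^α − 1 = mα/(m + 1) (principal power (m+1)^α := exp(α·ln(m+1))), and it is the only solution with negative real part: every complex α with Re α < 0 and (m + 1)^α − 1 = mα/(m + 1) equals −1. -/
/-- The exponential lies strictly below its chord on `[-L, 0]`. -/
theorem exp_mul_lt_chord {L x : ℝ} (hL : 0 < L) (hx : -1 < x) (hx0 : x < 0) :
    Real.exp (x * L) < 1 + (1 - Real.exp (-L)) * x := by
  have h := strictConvexOn_exp.2 (Set.mem_univ (-L)) (Set.mem_univ 0)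
    (by linarith : -L ≠ 0) (by linarith : 0 < -x) (by linarith : 0 < 1 + x) (by ring)
  simp only [smul_eq_mul, Real.exp_zero] at h
  rw [show -x * -L + (1 + x) * 0 = x * L by ring] at h
  linarith

/-- The exponential lies strictly above the chord of `[-L, 0]` to the left of `-L`. -/
theorem chord_lt_exp_mul {L x : ℝ} (hL : 0 < L) (hx : x < -1) :
    1 + (1 - Real.exp (-L)) * x < Real.exp (x * L) := by
  have hx0 : x ≠ 0 := by linarith
  have hinv : 0 < -x⁻¹ := by
    have := inv_lt_zero.2 (by linarith : x < 0)
    linarith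
  have hmul : x * x⁻¹ = 1 := mul_inv_cancel₀ hx0
  have hlt : 0 < 1 + x⁻¹ := by nlinarith
  have h := strictConvexOn_exp.2 (Set.mem_univ (x * L)) (Set.mem_univ 0)
    (by nlinarith : x * L ≠ 0) hinv hlt (by ring)
  simp only [smul_eq_mul, Real.exp_zero] at h
  rw [show -x⁻¹ * (x * L) + (1 + x⁻¹) * 0 = -L by linear_combination (-L) * hmul] at h
  have h' := mul_lt_mul_of_pos_left h (by linarith : 0 < -x)
  have e : -x * (-x⁻¹ * Real.exp (x * L) + (1 + x⁻¹) * 1) = Real.exp (x * L) - x - 1 := by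
    linear_combination (Real.exp (x * L) - 1) * hmul
  rw [e] at h'
  linarith

/-- In the closed half-plane `Re α ≤ -1`, the imaginary part of the equation
`exp (α L) = 1 + (1 - exp (-L)) α` forces `α` to be real. -/
theorem im_eq_zero_of_exp_mul_sin {L x y : ℝ} (hL : 0 < L) (hx : x ≤ -1)
    (h : Real.exp (x * L) * Real.sin (y * L) = (1 - Real.exp (-L)) * y) : y = 0 := by
  by_contra hy
  have hy' : 0 < |y| := abs_pos.2 hy
  have hc : L * Real.exp (-L) < 1 - Real.exp (-L) := by
    have h1 := Real.add_one_lt_exp hL.ne'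
    have h2 : Real.exp L * Real.exp (-L) = 1 := by rw [← Real.exp_add]; simp
    nlinarith [Real.exp_pos (-L)]
  have hc0 : 0 < 1 - Real.exp (-L) := lt_trans (by positivity) hc
  have hexp : Real.exp (x * L) ≤ Real.exp (-L) := Real.exp_le_exp.2 (by nlinarith)
  have hsin : |Real.sin (y * L)| ≤ |y| * L := by
    have := Real.abs_sin_le_abs (x := y * L)
    rwa [abs_mul, abs_of_pos hL] at this
  have habs := congrArg abs h
  rw [abs_mul, abs_mul, abs_of_pos (Real.exp_pos _), abs_of_pos hc0] at habs
  have hle : Real.exp (x * L) * |Real.sin (y * L)| ≤ Real.exp (-L) * (|y| * L) := by gcongr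
  nlinarith

/-- roots of `(m+1)^α − 1 = mα/(m+1)` with negative real part: for any
integer `m ≥ 1`, `α = −1` satisfies `(m+1)^α − 1 = mα/(m+1)` (principal-branch complex
power), and it is the only solution with `Re α < 0`. -/
theorem root_with_negative_real_part (m : ℕ) (hm : 1 ≤ m) :
    ((m : ℂ) + 1) ^ (-1 : ℂ) - 1 = (m : ℂ) * (-1) / ((m : ℂ) + 1) ∧
    ∀ α : ℂ, α.re < 0 → ((m : ℂ) + 1) ^ α - 1 = (m : ℂ) * α / ((m : ℂ) + 1) →
      α = -1 := by
  have hne : (m : ℂ) + 1 ≠ 0 := Nat.cast_add_one_ne_zero m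
  refine ⟨?_, fun α hα h => ?_⟩
  · rw [Complex.cpow_neg_one]
    field_simp
    ring
  have hm' : (1 : ℝ) ≤ m := by exact_mod_cast hm
  obtain ⟨L, hLdef⟩ : ∃ L, L = Real.log ((m : ℝ) + 1) := ⟨_, rfl⟩
  have hL : 0 < L := hLdef ▸ Real.log_pos (by linarith)
  have hexpL : Real.exp (-L) = ((m : ℝ) + 1)⁻¹ := by
    rw [Real.exp_neg, hLdef, Real.exp_log (by linarith)]
  have hlog : Complex.log ((m : ℂ) + 1) = (L : ℂ) := by
    rw [hLdef, Complex.ofReal_log (by linarith)]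
    push_cast
    rfl
  have heq : Complex.exp (α * L) = 1 + ((1 - Real.exp (-L) : ℝ) : ℂ) * α := by
    rw [Complex.cpow_def_of_ne_zero hne, hlog, mul_comm] at h
    rw [hexpL, sub_eq_iff_eq_add.1 h]
    push_cast
    field_simp
    ring
  have hre := congrArg Complex.re heq
  have him := congrArg Complex.im heq
  simp only [Complex.exp_re, Complex.exp_im, Complex.re_mul_ofReal, Complex.im_mul_ofReal,
    Complex.add_re, Complex.add_im, Complex.one_re, Complex.one_im, Complex.re_ofReal_mul,
    Complex.im_ofReal_mul, zero_add] at hre him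
  have hle : α.re ≤ -1 := by
    by_contra! hlt
    have h1 := exp_mul_lt_chord hL hlt hα
    have h2 := mul_le_of_le_one_right (Real.exp_pos (α.re * L)).le (Real.cos_le_one (α.im * L))
    linarith
  have hy := im_eq_zero_of_exp_mul_sin hL hle him
  rw [hy, zero_mul, Real.cos_zero, mul_one] at hre
  have hx : α.re = -1 := by
    refine hle.eq_of_not_lt fun hlt => ?_
    exact (chord_lt_exp_mul hL hlt).ne hre.symm
  apply Complex.ext <;> simp [hx, hy]
end

section
/- Let m ≥ 1 be an integer and let H : [0, 1] → ℝ be continuous on [0, 1] and differentiable on (0, 1), satisfying m·(1 − z)·H'(z) − H(z) = −(m + 1)·H(z^{m+1})·z^m·(1 − z)/(1 − z^{m+1}) for all z ∈ (0, 1). Then for every w ∈ (0, 1): ∫_{w^{m+1}}^{w} H(z)/(1 − z) dz = m·(H(w) − H(0)). -/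
/-- Example 5, the integration-by-parts identity (311): let `m ≥ 1` and
let `H : [0,1] → ℝ` be continuous on `[0,1]`, differentiable on `(0,1)`, and satisfy
`m(1−z)H'(z) − H(z) = −(m+1)·H(z^{m+1})·z^m·(1−z)/(1−z^{m+1})` on `(0,1)`.  Then for
every `w ∈ (0,1)`: `∫_{w^{m+1}}^w H(z)/(1−z) dz = m·(H(w) − H(0))`. -/
theorem H_integral_identity (m : ℕ) (hm : 1 ≤ m) (H : ℝ → ℝ)
    (hcont : ContinuousOn H (Set.Icc 0 1))
    (hdiff : ∀ z ∈ Set.Ioo (0 : ℝ) 1, DifferentiableAt ℝ H z)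
    (heq : ∀ z ∈ Set.Ioo (0 : ℝ) 1,
      (m : ℝ) * (1 - z) * deriv H z - H z =
        -((m : ℝ) + 1) * H (z ^ (m + 1)) * z ^ m * (1 - z) / (1 - z ^ (m + 1))) :
    ∀ w ∈ Set.Ioo (0 : ℝ) 1,
      ∫ z in (w ^ (m + 1))..w, H z / (1 - z) = (m : ℝ) * (H w - H 0) := by
  intro w hw
  have hpow : ∀ z ∈ Set.Icc (0 : ℝ) w, z ^ (m + 1) ∈ Set.Icc (0 : ℝ) w := fun z hz =>
    ⟨pow_nonneg hz.1 _,
      (pow_le_of_le_one hz.1 (hz.2.trans hw.2.le) m.succ_ne_zero).trans hz.2⟩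
  have hf : ContinuousOn (fun z => H z / (1 - z)) (Set.Icc 0 w) := by
    refine (hcont.mono (Set.Icc_subset_Icc_right hw.2.le)).div (by fun_prop) fun z hz => ?_
    linarith [hz.2, hw.2]
  have hu : Set.uIcc 0 w = Set.Icc 0 w := Set.uIcc_of_le hw.1.le
  have hd : ContinuousOn (fun z : ℝ => ((m : ℝ) + 1) * z ^ m) (Set.Icc 0 w) := by fun_prop
  have hg : ContinuousOn
      (fun z => ((fun z => H z / (1 - z)) ∘ fun z : ℝ => z ^ (m + 1)) z *
        (((m : ℝ) + 1) * z ^ m)) (Set.Icc 0 w) :=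
    (hf.comp (by fun_prop) hpow).mul hd
  have hfi : IntervalIntegrable (fun z => H z / (1 - z)) MeasureTheory.volume 0 w :=
    (hu ▸ hf).intervalIntegrable
  have hgi := ContinuousOn.intervalIntegrable (μ := MeasureTheory.volume) (hu.symm ▸ hg)
  have hw' := hpow w ⟨hw.1.le, le_rfl⟩
  have hfi' : IntervalIntegrable (fun z => H z / (1 - z)) MeasureTheory.volume 0 (w ^ (m + 1)) :=
    hfi.mono_set (by rw [hu, Set.uIcc_of_le hw'.1]; exact Set.Icc_subset_Icc_right hw'.2)
  have hsubst := intervalIntegral.integral_comp_mul_deriv' (a := 0) (b := w)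
    (f := fun z : ℝ => z ^ (m + 1)) (f' := fun z => ((m : ℝ) + 1) * z ^ m)
    (g := fun z => H z / (1 - z))
    (fun z _ => by simpa using hasDerivAt_pow (m + 1) z) (hu.symm ▸ hd)
    (hf.mono (by rw [hu]; exact Set.image_subset_iff.2 hpow))
  have hftc := intervalIntegral.integral_eq_sub_of_hasDerivAt_of_le (f := fun z => (m : ℝ) * H z)
    hw.1.le ((hcont.mono (Set.Icc_subset_Icc_right hw.2.le)).const_mul (m : ℝ))
    (fun z hz => by
      have hz1 : z ∈ Set.Ioo (0 : ℝ) 1 := ⟨hz.1, hz.2.trans hw.2⟩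
      have h1 : 1 - z ≠ 0 := by linarith [hz1.2]
      have h2 : 1 - z ^ (m + 1) ≠ 0 := by
        exact (sub_pos.2 (pow_lt_one₀ hz1.1.le hz1.2 m.succ_ne_zero)).ne'
      have h := heq z hz1
      refine ((hdiff z hz1).hasDerivAt.const_mul (m : ℝ)).congr_deriv ?_
      change _ = H z / (1 - z) - H (z ^ (m + 1)) / (1 - z ^ (m + 1)) * (((m : ℝ) + 1) * z ^ m)
      field_simp at h ⊢
      linear_combination h)
    (hfi.sub hgi)
  rw [intervalIntegral.integral_sub hfi hgi, hsubst] at hftc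
  rw [← intervalIntegral.integral_interval_sub_left hfi hfi', mul_sub, ← hftc]
  simp
end
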